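/- arXiv:nlin/0409065 — 14 statements merged into one kernel-verified Lean document; each statement's English description precedes it below -/
import Mathlib

section
/- Let x₁,x₂,x₃,x₄,y₁,y₂,y₃,y₄ be pairwise distinct real numbers and set Xⱼ = P(xⱼ), Yⱼ = P(yⱼ). Suppose A₁, A₂, A₃ ∈ ℝ² are points such that, for each j = 1,2,3, Aⱼ lies both on the line XⱼXⱼ₊₁ and on the line YⱼYⱼ₊₁. Then A₁, A₂, A₃ are collinear if and only if (x₁,y₂,x₃,y₄) = (y₁,x₂,y₃,x₄). -/
/-- The point `(t, t²)` on the parabola `y = x²`. -/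
noncomputable def Pb (t : ℝ) : ℝ × ℝ := (t, t ^ 2)

/-- The cross-ratio `(a,b,c,d) = ((a−b)/(b−c))·((c−d)/(d−a))`. -/
def crossRatio {K : Type*} [Field K] (a b c d : K) : K :=
  (a - b) / (b - c) * ((c - d) / (d - a))

/-- Three points of the plane are collinear iff their orientation determinant vanishes. -/
theorem collinear_triple_iff_det_eq_zero (A B C : ℝ × ℝ) :
    Collinear ℝ ({A, B, C} : Set (ℝ × ℝ)) ↔
      (B.1 - A.1) * (C.2 - A.2) - (B.2 - A.2) * (C.1 - A.1) = 0 := by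
  rw [collinear_iff_of_mem (p₀ := A) (by simp)]
  constructor
  · rintro ⟨v, hv⟩
    obtain ⟨r, rfl⟩ := hv B (by simp)
    obtain ⟨s, rfl⟩ := hv C (by simp)
    simp only [vadd_eq_add, Prod.fst_add, Prod.snd_add, Prod.smul_fst, Prod.smul_snd, smul_eq_mul]
    ring
  · intro h
    suffices H : ∃ v : ℝ × ℝ, (∃ r : ℝ, B = r • v +ᵥ A) ∧ ∃ r : ℝ, C = r • v +ᵥ A by
      obtain ⟨v, hB, hC⟩ := H
      refine ⟨v, ?_⟩
      rintro p (rfl | rfl | rfl)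
      · exact ⟨0, by simp⟩
      · exact hB
      · exact hC
    by_cases h₁ : B.1 - A.1 = 0
    · by_cases h₂ : B.2 - A.2 = 0
      · exact ⟨C - A, ⟨0, by ext <;> simp <;> linarith⟩, 1, by simp⟩
      · refine ⟨B - A, ⟨1, by simp⟩, (C.2 - A.2) / (B.2 - A.2), ?_⟩
        ext
        · simp only [vadd_eq_add, Prod.fst_add, Prod.smul_fst, smul_eq_mul, Prod.fst_sub]
          field_simp
          linear_combination -h
        · simp only [vadd_eq_add, Prod.snd_add, Prod.smul_snd, smul_eq_mul, Prod.snd_sub]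
          field_simp
          ring
    · refine ⟨B - A, ⟨1, by simp⟩, (C.1 - A.1) / (B.1 - A.1), ?_⟩
      ext
      · simp only [vadd_eq_add, Prod.fst_add, Prod.smul_fst, smul_eq_mul, Prod.fst_sub]
        field_simp
        ring
      · simp only [vadd_eq_add, Prod.snd_add, Prod.smul_snd, smul_eq_mul, Prod.snd_sub]
        field_simp
        linear_combination h

/-- A point on the chord of the parabola through the parameters `s` and `t`
satisfies the equation of that chord. -/
theorem snd_eq_of_mem_chord {s t : ℝ} {A : ℝ × ℝ} (h : A ∈ line[ℝ, Pb s, Pb t]) :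
    A.2 = (s + t) * A.1 - s * t := by
  obtain ⟨r, rfl⟩ := mem_affineSpan_pair_iff_exists_lineMap_eq.1 h
  simp only [Pb, AffineMap.lineMap_apply, vsub_eq_sub, vadd_eq_add, Prod.fst_add, Prod.snd_add,
    Prod.smul_fst, Prod.smul_snd, smul_eq_mul, Prod.fst_sub, Prod.snd_sub]
  ring

/-- Two chords of the parabola that share a point but no endpoint have different slopes. -/
theorem chord_slope_ne {s t u v : ℝ} {A : ℝ × ℝ} (h : A.2 = (s + t) * A.1 - s * t)
    (h' : A.2 = (u + v) * A.1 - u * v) (hu : s ≠ u) (hv : s ≠ v) :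
    s + t - (u + v) ≠ 0 := by
  intro h₀
  have : (s - u) * (s - v) = 0 := by linear_combination (s - A.1) * h₀ - h + h'
  rcases mul_eq_zero.1 this with h₁ | h₁
  · exact hu (sub_eq_zero.1 h₁)
  · exact hv (sub_eq_zero.1 h₁)

/-- The orientation determinant of three points, expressed through homogeneous coordinates
`(dᵢ, uᵢ, vᵢ)` of the points. -/
theorem mul_det_eq_of_homogeneous {A B C : ℝ × ℝ} {d₁ d₂ d₃ u₁ u₂ u₃ v₁ v₂ v₃ : ℝ}
    (hu₁ : d₁ * A.1 = u₁) (hv₁ : d₁ * A.2 = v₁) (hu₂ : d₂ * B.1 = u₂) (hv₂ : d₂ * B.2 = v₂)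
    (hu₃ : d₃ * C.1 = u₃) (hv₃ : d₃ * C.2 = v₃) :
    d₁ * d₂ * d₃ * ((B.1 - A.1) * (C.2 - A.2) - (B.2 - A.2) * (C.1 - A.1)) =
      d₁ * (u₂ * v₃ - v₂ * u₃) - d₂ * (u₁ * v₃ - v₁ * u₃) + d₃ * (u₁ * v₂ - v₁ * u₂) := by
  subst hu₁ hv₁ hu₂ hv₂ hu₃ hv₃
  ring

theorem stmt_0 (x₁ x₂ x₃ x₄ y₁ y₂ y₃ y₄ : ℝ)
    (hdist : List.Pairwise (· ≠ ·) [x₁, x₂, x₃, x₄, y₁, y₂, y₃, y₄])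
    (A₁ A₂ A₃ : ℝ × ℝ)
    (hA₁x : A₁ ∈ line[ℝ, Pb x₁, Pb x₂]) (hA₁y : A₁ ∈ line[ℝ, Pb y₁, Pb y₂])
    (hA₂x : A₂ ∈ line[ℝ, Pb x₂, Pb x₃]) (hA₂y : A₂ ∈ line[ℝ, Pb y₂, Pb y₃])
    (hA₃x : A₃ ∈ line[ℝ, Pb x₃, Pb x₄]) (hA₃y : A₃ ∈ line[ℝ, Pb y₃, Pb y₄]) :
    Collinear ℝ ({A₁, A₂, A₃} : Set (ℝ × ℝ)) ↔
      crossRatio x₁ y₂ x₃ y₄ = crossRatio y₁ x₂ y₃ x₄ := by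
  simp only [List.pairwise_cons, List.mem_cons, List.not_mem_nil, or_false, forall_eq_or_imp,
    forall_eq] at hdist
  obtain ⟨⟨_, _, _, h₁₁, h₁₂, _, h₁₄⟩, ⟨_, _, _, h₂₂, h₂₃, _⟩,
    ⟨_, _, h₃₂, h₃₃, h₃₄⟩, ⟨h₄₁, _⟩, _⟩ := hdist
  apply snd_eq_of_mem_chord at hA₁x
  apply snd_eq_of_mem_chord at hA₁y
  apply snd_eq_of_mem_chord at hA₂x
  apply snd_eq_of_mem_chord at hA₂y
  apply snd_eq_of_mem_chord at hA₃x
  apply snd_eq_of_mem_chord at hA₃y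
  have hD : (x₁ + x₂ - (y₁ + y₂)) * (x₂ + x₃ - (y₂ + y₃)) * (x₃ + x₄ - (y₃ + y₄)) ≠ 0 :=
    mul_ne_zero (mul_ne_zero (chord_slope_ne hA₁x hA₁y h₁₁ h₁₂)
      (chord_slope_ne hA₂x hA₂y h₂₂ h₂₃)) (chord_slope_ne hA₃x hA₃y h₃₃ h₃₄)
  have key := mul_det_eq_of_homogeneous (A := A₁) (B := A₂) (C := A₃)
    (d₁ := x₁ + x₂ - (y₁ + y₂)) (d₂ := x₂ + x₃ - (y₂ + y₃)) (d₃ := x₃ + x₄ - (y₃ + y₄))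
    (u₁ := x₁ * x₂ - y₁ * y₂) (u₂ := x₂ * x₃ - y₂ * y₃) (u₃ := x₃ * x₄ - y₃ * y₄)
    (v₁ := x₁ * x₂ * (y₁ + y₂) - (x₁ + x₂) * (y₁ * y₂))
    (v₂ := x₂ * x₃ * (y₂ + y₃) - (x₂ + x₃) * (y₂ * y₃))
    (v₃ := x₃ * x₄ * (y₃ + y₄) - (x₃ + x₄) * (y₃ * y₄))
    (by linear_combination hA₁y - hA₁x)
    (by linear_combination (x₁ + x₂) * hA₁y - (y₁ + y₂) * hA₁x)
    (by linear_combination hA₂y - hA₂x)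
    (by linear_combination (x₂ + x₃) * hA₂y - (y₂ + y₃) * hA₂x)
    (by linear_combination hA₃y - hA₃x)
    (by linear_combination (x₃ + x₄) * hA₃y - (y₃ + y₄) * hA₃x)
  have factored : (x₁ + x₂ - (y₁ + y₂)) * (x₂ + x₃ - (y₂ + y₃)) * (x₃ + x₄ - (y₃ + y₄)) *
      ((A₂.1 - A₁.1) * (A₃.2 - A₁.2) - (A₂.2 - A₁.2) * (A₃.1 - A₁.1)) =
      (x₂ - y₂) * (x₃ - y₃) * ((x₁ - y₂) * (x₃ - y₄) * ((x₂ - y₃) * (x₄ - y₁)) -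
        (y₁ - x₂) * (y₃ - x₄) * ((y₂ - x₃) * (y₄ - x₁))) := by
    rw [key]
    ring
  have hE : (x₂ - y₂) * (x₃ - y₃) ≠ 0 :=
    mul_ne_zero (sub_ne_zero.2 h₂₂) (sub_ne_zero.2 h₃₃)
  have hx : (y₂ - x₃) * (y₄ - x₁) ≠ 0 :=
    mul_ne_zero (sub_ne_zero.2 h₃₂.symm) (sub_ne_zero.2 h₁₄.symm)
  have hy : (x₂ - y₃) * (x₄ - y₁) ≠ 0 :=
    mul_ne_zero (sub_ne_zero.2 h₂₃) (sub_ne_zero.2 h₄₁)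
  rw [collinear_triple_iff_det_eq_zero, crossRatio, crossRatio, div_mul_div_comm,
    div_mul_div_comm, div_eq_div_iff hx hy, ← sub_eq_zero (a := (x₁ - y₂) * _ * _),
    ← mul_eq_zero_iff_left hD, factored, mul_eq_zero_iff_left hE]
end

section
/- Let y₂,y₁,u,x₁,x₂,p,v,q be pairwise distinct real numbers, with points Y₂ = P(y₂), Y₁ = P(y₁), U = P(u), X₁ = P(x₁), X₂ = P(x₂), P₀ = P(p), V = P(v), Q = P(q) on the parabola. Suppose A ∈ ℝ² lies on the lines X₁X₂ and Y₁Y₂, B lies on the lines UX₁ and P₀V, and C lies on the lines UY₁ and QV. Then A, B, C are collinear if and only if the multi-ratio (p,u,q,x₂,y₁,v,x₁,y₂) = 1. -/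
/-- The multi-ratio of eight elements:
`(a₁,…,a₈) = ((a₁−a₂)/(a₂−a₃))·((a₃−a₄)/(a₄−a₅))·((a₅−a₆)/(a₆−a₇))·((a₇−a₈)/(a₈−a₁))`. -/
def multiRatio8 {K : Type*} [Field K] (a₁ a₂ a₃ a₄ a₅ a₆ a₇ a₈ : K) : K :=
  (a₁ - a₂) / (a₂ - a₃) * ((a₃ - a₄) / (a₄ - a₅)) * ((a₅ - a₆) / (a₆ - a₇)) *
    ((a₇ - a₈) / (a₈ - a₁))

/-- A point of the chord through `Pb s` and `Pb t` satisfies the equation of that chord. -/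
lemma snd_eq_of_mem_line_Pb {s t : ℝ} {X : ℝ × ℝ} (h : X ∈ line[ℝ, Pb s, Pb t]) :
    X.2 = (s + t) * X.1 - s * t := by
  obtain ⟨r, rfl⟩ := mem_affineSpan_pair_iff_exists_lineMap_eq.1 h
  simp only [AffineMap.lineMap_apply, Pb, vsub_eq_sub, vadd_eq_add, Prod.mk_sub_mk, Prod.smul_mk,
    Prod.mk_add_mk, smul_eq_mul]
  ring

/-- Three points of the plane are collinear iff the cross product of the difference vectors from
the first point vanishes. -/
lemma collinear_triple_iff_cross_eq_zero {K : Type*} [Field K] (A B C : K × K) :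
    Collinear K ({A, B, C} : Set (K × K)) ↔
      (B.1 - A.1) * (C.2 - A.2) - (B.2 - A.2) * (C.1 - A.1) = 0 := by
  rw [collinear_iff_of_mem (p₀ := A) (by simp)]
  constructor
  · rintro ⟨w, hw⟩
    obtain ⟨r, rfl⟩ := hw B (by simp)
    obtain ⟨s, rfl⟩ := hw C (by simp)
    simp only [vadd_eq_add, Prod.fst_add, Prod.snd_add, Prod.smul_fst, Prod.smul_snd, smul_eq_mul]
    ring
  · intro h
    suffices ∃ w : K × K, (∃ r : K, B = r • w + A) ∧ ∃ r : K, C = r • w + A by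
      obtain ⟨w, hB, hC⟩ := this
      refine ⟨w, ?_⟩
      rintro X (rfl | rfl | rfl)
      · exact ⟨0, by simp⟩
      · exact hB
      · exact hC
    by_cases h₁ : B.1 - A.1 = 0
    · by_cases h₂ : B.2 - A.2 = 0
      · exact ⟨C - A, ⟨0, by ext <;> simp [sub_eq_zero.1 h₁, sub_eq_zero.1 h₂]⟩, 1, by simp⟩
      · refine ⟨B - A, ⟨1, by simp⟩, (C.2 - A.2) / (B.2 - A.2), ?_⟩
        ext <;> simp only [Prod.fst_add, Prod.snd_add, Prod.smul_fst, Prod.smul_snd, smul_eq_mul,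
          Prod.fst_sub, Prod.snd_sub]
        · field_simp
          linear_combination -h
        · field_simp
          ring
    · refine ⟨B - A, ⟨1, by simp⟩, (C.1 - A.1) / (B.1 - A.1), ?_⟩
      ext <;> simp only [Prod.fst_add, Prod.snd_add, Prod.smul_fst, Prod.smul_snd, smul_eq_mul,
        Prod.fst_sub, Prod.snd_sub]
      · field_simp
        ring
      · field_simp
        linear_combination h

/-- Two chords of the parabola that share a point and whose endpoints satisfy `a ≠ c`, `a ≠ d`
are not parallel, and the abscissa of the common point is given by the usual formula. -/
lemma chords_inter {a b c d : ℝ} {X : ℝ × ℝ} (hac : a ≠ c) (had : a ≠ d)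
    (h₁ : X ∈ line[ℝ, Pb a, Pb b]) (h₂ : X ∈ line[ℝ, Pb c, Pb d]) :
    a + b - c - d ≠ 0 ∧ X.1 = (a * b - c * d) / (a + b - c - d) := by
  have e₁ := snd_eq_of_mem_line_Pb h₁
  have e₂ := snd_eq_of_mem_line_Pb h₂
  have hX : X.1 * (a + b - c - d) = a * b - c * d := by linear_combination e₂ - e₁
  have hD : a + b - c - d ≠ 0 := by
    intro hD
    refine mul_ne_zero (sub_ne_zero.2 hac) (sub_ne_zero.2 had) ?_
    linear_combination (a - X.1) * hD + hX
  exact ⟨hD, eq_div_of_mul_eq hD hX⟩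

theorem stmt_1 (y₂ y₁ u x₁ x₂ p v q : ℝ)
    (hdist : List.Pairwise (· ≠ ·) [y₂, y₁, u, x₁, x₂, p, v, q])
    (A B C : ℝ × ℝ)
    (hAx : A ∈ line[ℝ, Pb x₁, Pb x₂]) (hAy : A ∈ line[ℝ, Pb y₁, Pb y₂])
    (hB₁ : B ∈ line[ℝ, Pb u, Pb x₁]) (hB₂ : B ∈ line[ℝ, Pb p, Pb v])
    (hC₁ : C ∈ line[ℝ, Pb u, Pb y₁]) (hC₂ : C ∈ line[ℝ, Pb q, Pb v]) :
    Collinear ℝ ({A, B, C} : Set (ℝ × ℝ)) ↔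
      multiRatio8 p u q x₂ y₁ v x₁ y₂ = 1 := by
  simp only [List.pairwise_cons, List.mem_cons, List.not_mem_nil, or_false, forall_eq_or_imp,
    forall_eq, ne_eq] at hdist
  obtain ⟨⟨-, -, hyx, -, hyp, -, -⟩, ⟨-, hy₁x₁, hy₁x₂, -, -, -⟩, ⟨-, -, hup, huv, huq⟩,
    ⟨-, -, hxv, -⟩, -⟩ := hdist
  obtain ⟨hDA, hA⟩ := chords_inter (Ne.symm hy₁x₁) (Ne.symm hyx) hAx hAy
  obtain ⟨hDB, hB⟩ := chords_inter hup huv hB₁ hB₂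
  obtain ⟨hDC, hC⟩ := chords_inter huq huv hC₁ hC₂
  have key : (B.1 - A.1) * (C.2 - A.2) - (B.2 - A.2) * (C.1 - A.1) =
      -((u - v) * (x₁ - y₁) / ((x₁ + x₂ - y₁ - y₂) * (u + x₁ - p - v) * (u + y₁ - q - v))) *
        ((p - u) * (q - x₂) * (y₁ - v) * (x₁ - y₂) -
          (u - q) * (x₂ - y₁) * (v - x₁) * (y₂ - p)) := by
    rw [snd_eq_of_mem_line_Pb hAx, snd_eq_of_mem_line_Pb hB₁, snd_eq_of_mem_line_Pb hC₁,
      hA, hB, hC]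
    field_simp
    ring
  have hfactor : -((u - v) * (x₁ - y₁) /
      ((x₁ + x₂ - y₁ - y₂) * (u + x₁ - p - v) * (u + y₁ - q - v))) ≠ 0 :=
    neg_ne_zero.2 (div_ne_zero (mul_ne_zero (sub_ne_zero.2 huv) (sub_ne_zero.2 (Ne.symm hy₁x₁)))
      (mul_ne_zero (mul_ne_zero hDA hDB) hDC))
  have hden : (u - q) * (x₂ - y₁) * (v - x₁) * (y₂ - p) ≠ 0 :=
    mul_ne_zero (mul_ne_zero (mul_ne_zero (sub_ne_zero.2 huq) (sub_ne_zero.2 (Ne.symm hy₁x₂)))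
      (sub_ne_zero.2 (Ne.symm hxv))) (sub_ne_zero.2 hyp)
  rw [collinear_triple_iff_cross_eq_zero, key, mul_eq_zero, or_iff_right hfactor, sub_eq_zero,
    multiRatio8, div_mul_div_comm, div_mul_div_comm, div_mul_div_comm, div_eq_one_iff_eq hden]
end

section
/- (Möbius theorem, even case, for the parabola.) Let N = 2n with n ≥ 2, let x₁,…,x_N, y₁,…,y_N be 2N pairwise distinct real numbers, and set Xⱼ = P(xⱼ), Yⱼ = P(yⱼ), with the cyclic conventions X_{N+1} = X₁ and Y_{N+1} = Y₁. Suppose A₁,…,A_N ∈ ℝ² are points such that, for each j = 1,…,N, Aⱼ lies both on the line XⱼXⱼ₊₁ and on the line YⱼYⱼ₊₁. If A₁,…,A_{N−1} are collinear, then A₁,…,A_N are collinear. -/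
/-- Conjugacy relation of `s` and `t`: for `r = 1`, the chord of the parabola `y = x²` joining the
points of parameters `s` and `t` passes through `(p, w)`. -/
def ChordRel (r p w s t : ℝ) : Prop := r * (s * t) - p * (s + t) + w = 0

theorem chordRel_of_mem_line {A : ℝ × ℝ} {s t : ℝ} (h : A ∈ line[ℝ, Pb s, Pb t]) :
    ChordRel 1 A.1 A.2 s t := by
  obtain ⟨c, rfl⟩ := mem_affineSpan_pair_iff_exists_lineMap_eq.1 h
  simp only [ChordRel, AffineMap.lineMap_apply, Pb, vsub_eq_sub, vadd_eq_add, Prod.fst_add,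
    Prod.snd_add, Prod.smul_fst, Prod.smul_snd, Prod.fst_sub, Prod.snd_sub, smul_eq_mul]
  ring

/-- A point lying on two chords without common endpoints is not on the parabola. -/
theorem ChordRel.sub_sq_ne_zero {a b s t u v : ℝ} (h : ChordRel 1 a b s t)
    (h' : ChordRel 1 a b u v) (hsu : s ≠ u) (hsv : s ≠ v) (htu : t ≠ u) (htv : t ≠ v) :
    b - a ^ 2 ≠ 0 := by
  intro h0
  unfold ChordRel at h h'
  have h1 : (s - a) * (t - a) = 0 := by linear_combination h - h0
  have h2 : (u - a) * (v - a) = 0 := by linear_combination h' - h0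
  rcases mul_eq_zero.1 h1 with h1 | h1 <;> rcases mul_eq_zero.1 h2 with h2 | h2
  · exact hsu (by linarith)
  · exact hsv (by linarith)
  · exact htu (by linarith)
  · exact htv (by linarith)

/-- Three conjugacies whose centres lie on a common line compose to a conjugacy whose centre lies
on that line. The parameters of the composite do not depend on the points it is applied to. -/
theorem exists_chordRel_comp (p₁ p₂ v₁ v₂ r s d c : ℝ)
    (h₀ : r * (r * p₂ + s * v₂) - (r * p₁ + s * v₁) ^ 2 ≠ 0)
    (hd : p₂ + d * v₂ - (p₁ + d * v₁) ^ 2 ≠ 0) (hc : p₂ + c * v₂ - (p₁ + c * v₁) ^ 2 ≠ 0) :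
    ∃ r' s' : ℝ, r' * (r' * p₂ + s' * v₂) - (r' * p₁ + s' * v₁) ^ 2 ≠ 0 ∧
      ∀ t₀ t₁ t₂ t₃ : ℝ, ChordRel r (r * p₁ + s * v₁) (r * p₂ + s * v₂) t₀ t₁ →
        ChordRel 1 (p₁ + d * v₁) (p₂ + d * v₂) t₁ t₂ →
        ChordRel 1 (p₁ + c * v₁) (p₂ + c * v₂) t₂ t₃ →
        ChordRel r' (r' * p₁ + s' * v₁) (r' * p₂ + s' * v₂) t₀ t₃ := by
  refine ⟨r * (p₁ ^ 2 - p₂) + d * r * (2 * p₁ * v₁ - v₂) + c * d * r * v₁ ^ 2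
      + s * d * v₁ ^ 2 - c * s * v₁ ^ 2,
    (c * r - d * r + s) * (p₁ ^ 2 - p₂) + c * s * (2 * p₁ * v₁ - v₂) + c * d * s * v₁ ^ 2, ?_, ?_⟩
  · convert mul_ne_zero (mul_ne_zero hc hd) h₀ using 1
    ring
  · intro t₀ t₁ t₂ t₃ e₀ e₁ e₂
    unfold ChordRel at *
    linear_combination (r * t₀ - (r * p₁ + s * v₁)) * (t₁ - (p₁ + d * v₁)) * e₂
      + (r * t₀ - (r * p₁ + s * v₁)) * ((p₁ + c * v₁) - t₃) * e₁
      + ((p₁ + d * v₁) * (p₁ + c * v₁) - (p₂ + c * v₂)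
          - t₃ * ((p₁ + d * v₁) - (p₁ + c * v₁))) * e₀

/-- A nondegenerate conjugacy `(r, p, w)` relating the endpoints of each of two chords without
common endpoints has as its (finite) centre the common point `(a, b)` of these chords. -/
theorem ChordRel.center_eq {r p w a b s t u v : ℝ} (hdet : r * w - p ^ 2 ≠ 0)
    (h : ChordRel r p w s t) (h' : ChordRel r p w u v)
    (e : ChordRel 1 a b s t) (e' : ChordRel 1 a b u v) (hsu : s ≠ u) (hsv : s ≠ v) :
    r ≠ 0 ∧ p = r * a ∧ w = r * b := by
  unfold ChordRel at *
  have hsum : s + t - (u + v) ≠ 0 := by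
    intro h0
    have : (s - u) * (s - v) = 0 := by linear_combination (s - a) * h0 - e + e'
    rcases mul_eq_zero.1 this with h1 | h1
    · exact hsu (by linarith)
    · exact hsv (by linarith)
  have hp : p = r * a := by
    apply mul_right_cancel₀ hsum
    linear_combination h' - h + r * e - r * e'
  have hw : w = r * b := by linear_combination h - r * e + (s + t) * hp
  refine ⟨?_, hp, hw⟩
  rintro rfl
  apply hdet
  rw [hp]
  ring

/-- Möbius theorem (even case) for the parabola.  Indices are taken in
`ZMod (2*n)`, the index `0` representing the original index `N = 2*n`,
so that the cyclic conventions `X_{N+1} = X₁`, `Y_{N+1} = Y₁` hold. -/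
theorem stmt_3 (n : ℕ) (hn : 2 ≤ n)
    (x y : ZMod (2 * n) → ℝ)
    (hdist : Function.Injective (Sum.elim x y))
    (A : ZMod (2 * n) → ℝ × ℝ)
    (hAx : ∀ j, A j ∈ line[ℝ, Pb (x j), Pb (x (j + 1))])
    (hAy : ∀ j, A j ∈ line[ℝ, Pb (y j), Pb (y (j + 1))])
    (hcol : Collinear ℝ (A '' {j | j ≠ 0})) :
    Collinear ℝ (Set.range A) := by
  have hxy : ∀ i j, x i ≠ y j := fun i j h => by
    have := hdist (a₁ := Sum.inl i) (a₂ := Sum.inr j) h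
    cases this
  have hx j := chordRel_of_mem_line (hAx j)
  have hy j := chordRel_of_mem_line (hAy j)
  have hA : ∀ j, (A j).2 - (A j).1 ^ 2 ≠ 0 := fun j =>
    (hx j).sub_sq_ne_zero (hy j) (hxy _ _) (hxy _ _) (hxy _ _) (hxy _ _)
  obtain ⟨⟨p₁, p₂⟩, ⟨v₁, v₂⟩, hpv⟩ := (collinear_iff_exists_forall_eq_smul_vadd _).1 hcol
  have hc : ∀ j, j ≠ 0 → ∃ c : ℝ, A j = (p₁ + c * v₁, p₂ + c * v₂) := fun j hj => by
    obtain ⟨c, h⟩ := hpv (A j) ⟨j, hj, rfl⟩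
    exact ⟨c, by rw [h]; ext <;> simp [add_comm]⟩
  have hcast : ∀ m : ℕ, 0 < m → m < 2 * n → (m : ZMod (2 * n)) ≠ 0 := fun m h0 h1 h => by
    rw [ZMod.natCast_eq_zero_iff] at h
    exact absurd (Nat.le_of_dvd h0 h) (by omega)
  have key : ∀ k : ℕ, k < n → ∃ r s : ℝ,
      r * (r * p₂ + s * v₂) - (r * p₁ + s * v₁) ^ 2 ≠ 0 ∧
      ChordRel r (r * p₁ + s * v₁) (r * p₂ + s * v₂) (x 1) (x ((2 * k + 2 : ℕ))) ∧
      ChordRel r (r * p₁ + s * v₁) (r * p₂ + s * v₂) (y 1) (y ((2 * k + 2 : ℕ))) := by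
    intro k
    induction k with
    | zero =>
      intro _
      obtain ⟨c, h⟩ := hc 1 (by simpa using hcast 1 one_pos (by omega))
      have h2 : ((2 * 0 + 2 : ℕ) : ZMod (2 * n)) = 1 + 1 := by push_cast; ring
      have h3 := hA 1
      have h4 := hx 1
      have h5 := hy 1
      rw [h] at h3 h4 h5
      refine ⟨1, c, ?_, ?_, ?_⟩
      · simpa using h3
      · rw [h2]; simpa using h4
      · rw [h2]; simpa using h5
    | succ k ih =>
      intro hk
      obtain ⟨r, s, h0, ex, ey⟩ := ih (by omega)
      obtain ⟨d, hd⟩ := hc _ (hcast (2 * k + 2) (by omega) (by omega))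
      obtain ⟨c, hc⟩ := hc _ (hcast (2 * k + 3) (by omega) (by omega))
      have e1 : ((2 * k + 2 : ℕ) : ZMod (2 * n)) + 1 = (2 * k + 3 : ℕ) := by push_cast; ring
      have e2 : ((2 * k + 3 : ℕ) : ZMod (2 * n)) + 1 = (2 * (k + 1) + 2 : ℕ) := by
        push_cast; ring
      have d1 := hA (2 * k + 2 : ℕ)
      have d2 := hA (2 * k + 3 : ℕ)
      have x1 := hx (2 * k + 2 : ℕ)
      have x2 := hx (2 * k + 3 : ℕ)
      have y1 := hy (2 * k + 2 : ℕ)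
      have y2 := hy (2 * k + 3 : ℕ)
      rw [hd] at d1
      rw [hc] at d2
      rw [hd, e1] at x1 y1
      rw [hc, e2] at x2 y2
      obtain ⟨r', s', h', H⟩ := exists_chordRel_comp p₁ p₂ v₁ v₂ r s d c h0 d1 d2
      exact ⟨r', s', h', H _ _ _ _ ex x1 x2, H _ _ _ _ ey y1 y2⟩
  obtain ⟨r, s, hdet, ex, ey⟩ := key (n - 1) (by omega)
  have h0 : ((2 * (n - 1) + 2 : ℕ) : ZMod (2 * n)) = 0 := by
    rw [show 2 * (n - 1) + 2 = 2 * n by omega, ZMod.natCast_self]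
  rw [h0] at ex ey
  have fx := hx 0
  have fy := hy 0
  rw [zero_add] at fx fy
  obtain ⟨hr, hp, hw⟩ := ChordRel.center_eq hdet ex ey
    (by unfold ChordRel at *; linarith) (by unfold ChordRel at *; linarith)
    (hxy _ _) (hxy _ _) (a := (A 0).1) (b := (A 0).2)
  refine (collinear_iff_exists_forall_eq_smul_vadd _).2 ⟨(p₁, p₂), (v₁, v₂), ?_⟩
  rintro _ ⟨j, rfl⟩
  by_cases hj : j = 0
  · subst hj
    refine ⟨s / r, ?_⟩
    ext
    · simp only [vadd_eq_add, Prod.fst_add, Prod.smul_fst, smul_eq_mul]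
      field_simp
      linarith
    · simp only [vadd_eq_add, Prod.snd_add, Prod.smul_snd, smul_eq_mul]
      field_simp
      linarith
  · exact hpv _ ⟨j, hj, rfl⟩
end

section
/- (Möbius theorem, odd case, for the parabola.) Let N = 2n+1 with n ≥ 1, let x₁,…,x_N, y₁,…,y_N be 2N pairwise distinct real numbers, and set Xⱼ = P(xⱼ), Yⱼ = P(yⱼ). Suppose A₁,…,A_N ∈ ℝ² are points such that Aⱼ lies both on the line XⱼXⱼ₊₁ and on the line YⱼYⱼ₊₁ for j = 1,…,N−1, and A_N lies both on the line X_N Y₁ and on the line Y_N X₁. If A₁,…,A_{N−1} are collinear, then A₁,…,A_N are collinear. -/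
theorem mem_line_Pb {a b : ℝ} {p : ℝ × ℝ} (h : p ∈ line[ℝ, Pb a, Pb b]) :
    p.2 = (a + b) * p.1 - a * b := by
  obtain ⟨r, rfl⟩ := mem_affineSpan_pair_iff_exists_lineMap_eq.1 h
  simp only [Pb, AffineMap.lineMap_apply, vsub_eq_sub, vadd_eq_add, Prod.mk_sub_mk,
    Prod.smul_mk, Prod.mk_add_mk, smul_eq_mul]
  ring

/-- A set of points of the plane is collinear iff its points satisfy a common line equation. -/
theorem collinear_iff_exists_line_eq (s : Set (ℝ × ℝ)) :
    Collinear ℝ s ↔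
      ∃ α β γ : ℝ, 0 < α ^ 2 + β ^ 2 ∧ ∀ p ∈ s, α * p.1 + β * p.2 + γ = 0 := by
  rw [collinear_iff_exists_forall_eq_smul_vadd]
  constructor
  · rintro ⟨⟨p₁, p₂⟩, ⟨v₁, v₂⟩, h⟩
    by_cases hv : v₁ = 0 ∧ v₂ = 0
    · obtain ⟨rfl, rfl⟩ := hv
      refine ⟨1, 0, -p₁, by norm_num, fun p hp => ?_⟩
      obtain ⟨r, rfl⟩ := h p hp
      simp
    · refine ⟨v₂, -v₁, v₁ * p₂ - v₂ * p₁, ?_, fun p hp => ?_⟩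
      · by_contra! hle
        exact hv ⟨by nlinarith [sq_nonneg v₁, sq_nonneg v₂],
          by nlinarith [sq_nonneg v₁, sq_nonneg v₂]⟩
      · obtain ⟨r, rfl⟩ := h p hp
        simp only [vadd_eq_add, Prod.smul_mk, Prod.mk_add_mk, smul_eq_mul]
        ring
  · rintro ⟨α, β, γ, hpos, h⟩
    refine ⟨(-γ / (α ^ 2 + β ^ 2) * α, -γ / (α ^ 2 + β ^ 2) * β), (β, -α), fun p hp => ?_⟩
    have hp := h p hp
    refine ⟨(β * p.1 - α * p.2) / (α ^ 2 + β ^ 2), ?_⟩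
    have hne := hpos.ne'
    ext
    · simp only [vadd_eq_add, Prod.smul_mk, Prod.mk_add_mk, smul_eq_mul]
      field_simp
      linear_combination α * hp
    · simp only [vadd_eq_add, Prod.smul_mk, Prod.mk_add_mk, smul_eq_mul]
      field_simp
      linear_combination β * hp

/-- The symmetric bilinear form polar to the restriction of `α X + β Y + γ` to the parabola. -/
noncomputable def linePolar (α β γ s t : ℝ) : ℝ := α * (s + t) / 2 + β * (s * t) + γ

theorem linePolar_comm (α β γ s t : ℝ) : linePolar α β γ s t = linePolar α β γ t s := by
  unfold linePolar
  ring

/-- The value of a linear equation at the meeting point of two chords of the parabola, expressed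
through the polar form. -/
theorem linePolar_of_mem_lines (α β γ : ℝ) {a b c d : ℝ} {p : ℝ × ℝ}
    (h : p ∈ line[ℝ, Pb a, Pb b]) (h' : p ∈ line[ℝ, Pb c, Pb d]) :
    (a - c) * linePolar α β γ b d + (b - d) * linePolar α β γ a c =
      (a + b - (c + d)) * (α * p.1 + β * p.2 + γ) := by
  have e := mem_line_Pb h
  have e' := mem_line_Pb h'
  unfold linePolar
  linear_combination (α + β * (c + d)) * e - (α + β * (a + b)) * e'

/-- Two chords with a common point whose endpoints have equal sums share an endpoint. -/
theorem add_ne_add_of_mem_lines {a b c d : ℝ} {p : ℝ × ℝ}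
    (h : p ∈ line[ℝ, Pb a, Pb b]) (h' : p ∈ line[ℝ, Pb c, Pb d])
    (hac : a ≠ c) (had : a ≠ d) : a + b - (c + d) ≠ 0 := by
  intro hs
  have e := mem_line_Pb h
  have e' := mem_line_Pb h'
  refine mul_ne_zero (sub_ne_zero.2 hac) (sub_ne_zero.2 had) ?_
  linear_combination (a - p.1) * hs + e' - e

/-- Möbius theorem (odd case) for the parabola.  Here `N = 2*n+1`, the
index `i : Fin N` represents the original index `i+1`, so `0` is the first
index and `Fin.last` is the index `N`. -/
theorem stmt_4 (n : ℕ) (hn : 1 ≤ n)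
    (x y : Fin (2 * n + 1) → ℝ)
    (hdist : Function.Injective (Sum.elim x y))
    (A : Fin (2 * n + 1) → ℝ × ℝ)
    (hAx : ∀ j : Fin (2 * n), A j.castSucc ∈ line[ℝ, Pb (x j.castSucc), Pb (x j.succ)])
    (hAy : ∀ j : Fin (2 * n), A j.castSucc ∈ line[ℝ, Pb (y j.castSucc), Pb (y j.succ)])
    (hANx : A (Fin.last (2 * n)) ∈ line[ℝ, Pb (x (Fin.last (2 * n))), Pb (y 0)])
    (hANy : A (Fin.last (2 * n)) ∈ line[ℝ, Pb (y (Fin.last (2 * n))), Pb (x 0)])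
    (hcol : Collinear ℝ (A '' {j | j ≠ Fin.last (2 * n)})) :
    Collinear ℝ (Set.range A) := by
  obtain ⟨α, β, γ, hpos, hL⟩ := (collinear_iff_exists_line_eq _).1 hcol
  have hxy (i j) : x i ≠ y j := fun h => Sum.inl_ne_inr (hdist (a₁ := .inl i) (a₂ := .inr j) h)
  have hu (i) : x i - y i ≠ 0 := sub_ne_zero.2 (hxy i i)
  have hLj (j : Fin (2 * n)) : α * (A j.castSucc).1 + β * (A j.castSucc).2 + γ = 0 :=
    hL _ ⟨_, (Fin.castSucc_lt_last j).ne, rfl⟩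
  have alternate (i : Fin (2 * n + 1)) : linePolar α β γ (x i) (y i) / (x i - y i) =
      (-1) ^ (i : ℕ) * (linePolar α β γ (x 0) (y 0) / (x 0 - y 0)) := by
    induction i using Fin.induction with
    | zero => simp
    | succ j ih =>
      have key := linePolar_of_mem_lines α β γ (hAx j) (hAy j)
      rw [hLj j, mul_zero] at key
      rw [Fin.val_succ, pow_succ, mul_right_comm, ← Fin.val_castSucc, ← ih, mul_neg_one,
        ← neg_div, div_eq_div_iff (hu _) (hu _)]
      linear_combination key
  have hlast := alternate (Fin.last (2 * n))
  rw [Fin.val_last, (even_two_mul n).neg_one_pow, one_mul, div_eq_div_iff (hu _) (hu _)] at hlast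
  have key := linePolar_of_mem_lines α β γ hANx hANy
  rw [linePolar_comm α β γ (y 0)] at key
  have hx0 : x (Fin.last (2 * n)) ≠ x 0 := fun h => by
    have := congrArg Fin.val (Sum.inl_injective (hdist (a₁ := .inl _) (a₂ := .inl _) h))
    simp at this
    omega
  have hAN : α * (A (Fin.last (2 * n))).1 + β * (A (Fin.last (2 * n))).2 + γ = 0 := by
    refine (mul_eq_zero.1 ?_).resolve_left
      (add_ne_add_of_mem_lines hANx hANy (hxy _ _) hx0)
    linear_combination -key - hlast
  refine (collinear_iff_exists_line_eq _).2 ⟨α, β, γ, hpos, ?_⟩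
  rintro _ ⟨i, rfl⟩
  exact Fin.lastCases hAN hLj i
end

section
/- (Möbius theorem, even case, parallel-chords form.) Let N = 2n with n ≥ 2 and let x₁,…,x_N, y₁,…,y_N be real numbers such that for every j (indices taken cyclically modulo N) xⱼ ≢ xⱼ₊₁ (mod 2π) and yⱼ ≢ yⱼ₊₁ (mod 2π). Set C(θ) = (cos θ, sin θ). If for each j = 1,…,N−1 the vector C(xⱼ₊₁) − C(xⱼ) is a nonzero real scalar multiple of C(yⱼ₊₁) − C(yⱼ), then C(x₁) − C(x_N) is a nonzero real scalar multiple of C(y₁) − C(y_N). -/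
open Real

/-- The point `(cos θ, sin θ)` on the unit circle. -/
noncomputable def Cp (θ : ℝ) : ℝ × ℝ := (Real.cos θ, Real.sin θ)

theorem sin_half_sub_ne_zero {a b : ℝ} (h : ¬ a ≡ b [PMOD (2 * π)]) :
    sin ((b - a) / 2) ≠ 0 := by
  intro hs
  obtain ⟨k, hk⟩ := sin_eq_zero_iff.1 hs
  refine h (AddCommGroup.modEq_iff_zsmul.2 ⟨k, ?_⟩)
  rw [zsmul_eq_mul]
  linarith

theorem Cp_sub_Cp (a b : ℝ) :
    Cp b - Cp a =
      (-2 * sin ((b - a) / 2) * sin ((a + b) / 2), 2 * sin ((b - a) / 2) * cos ((a + b) / 2)) := by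
  simp only [Cp, Prod.mk_sub_mk, Prod.mk.injEq, cos_sub_cos, sin_sub_sin, add_comm b a]
  exact ⟨by ring, trivial⟩

/-- Two nondegenerate chords of the unit circle are parallel iff the half-sums of the angles of
their endpoints differ by a multiple of `π`. -/
theorem chords_parallel_iff {a b c d : ℝ} (hab : ¬ a ≡ b [PMOD (2 * π)])
    (hcd : ¬ c ≡ d [PMOD (2 * π)]) :
    (∃ t : ℝ, t ≠ 0 ∧ Cp b - Cp a = t • (Cp d - Cp c)) ↔
      sin ((a + b) / 2 - (c + d) / 2) = 0 := by
  have h₁ := sin_half_sub_ne_zero hab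
  have h₂ := sin_half_sub_ne_zero hcd
  rw [Cp_sub_Cp, Cp_sub_Cp]
  generalize sin ((b - a) / 2) = p at *
  generalize sin ((d - c) / 2) = q at *
  generalize (a + b) / 2 = u
  generalize (c + d) / 2 = v
  constructor
  · rintro ⟨t, -, h⟩
    simp only [Prod.smul_mk, smul_eq_mul, Prod.mk.injEq] at h
    obtain ⟨e₁, e₂⟩ := h
    refine (mul_eq_zero_iff_left h₁).1 ?_
    rw [sin_sub]
    linear_combination (-cos v / 2) * e₁ - (sin v / 2) * e₂
  · intro h
    have hc : cos (u - v) ≠ 0 := by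
      intro hc
      have := sin_sq_add_cos_sq (u - v)
      simp [h, hc] at this
    refine ⟨p / q * cos (u - v), mul_ne_zero (div_ne_zero h₁ h₂) hc, ?_⟩
    have hs : sin u = sin v * cos (u - v) := by
      conv_lhs => rw [← add_sub_cancel v u, sin_add, h]
      ring
    have hco : cos u = cos v * cos (u - v) := by
      conv_lhs => rw [← add_sub_cancel v u, cos_add, h]
      ring
    simp only [Prod.smul_mk, smul_eq_mul, Prod.mk.injEq]
    constructor
    · rw [hs]
      field_simp
    · rw [hco]
      field_simp

/-- Möbius theorem (even case) in parallel-chords form.  Indices are taken in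
`ZMod (2*n)`, the index `0` representing the original index `N = 2*n`, so the
pair `(x 0, x 1)` is the chord `X_N X₁` of the conclusion. -/
theorem stmt_6 (n : ℕ) (hn : 2 ≤ n)
    (x y : ZMod (2 * n) → ℝ)
    (hx : ∀ j, ¬ x j ≡ x (j + 1) [PMOD (2 * π)])
    (hy : ∀ j, ¬ y j ≡ y (j + 1) [PMOD (2 * π)])
    (hpar : ∀ j : ZMod (2 * n), j ≠ 0 →
      ∃ t : ℝ, t ≠ 0 ∧ Cp (x (j + 1)) - Cp (x j) = t • (Cp (y (j + 1)) - Cp (y j))) :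
    ∃ t : ℝ, t ≠ 0 ∧ Cp (x 1) - Cp (x 0) = t • (Cp (y 1) - Cp (y 0)) := by
  have hstep : ∀ j : ZMod (2 * n), j ≠ 0 →
      ∃ k : ℤ, x (j + 1) - y (j + 1) = -(x j - y j) + k * (2 * π) := by
    intro j hj
    obtain ⟨k, hk⟩ := sin_eq_zero_iff.1 ((chords_parallel_iff (hx j) (hy j)).1 (hpar j hj))
    exact ⟨k, by linarith⟩
  have halt : ∀ i : ℕ, i < 2 * n → ∃ k : ℤ,
      x ((i + 1 : ℕ) : ZMod (2 * n)) - y ((i + 1 : ℕ) : ZMod (2 * n)) =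
        (-1) ^ i * (x 1 - y 1) + k * (2 * π) := by
    intro i
    induction i with
    | zero => exact fun _ => ⟨0, by simp⟩
    | succ i ih =>
      intro hi
      obtain ⟨k, hk⟩ := ih (by omega)
      have hne : ((i + 1 : ℕ) : ZMod (2 * n)) ≠ 0 := by
        rw [Ne, ZMod.natCast_eq_zero_iff]
        exact Nat.not_dvd_of_pos_of_lt i.succ_pos hi
      obtain ⟨l, hl⟩ := hstep _ hne
      refine ⟨l - k, ?_⟩
      rw [Nat.cast_succ (i + 1), hl, hk, pow_succ]
      push_cast
      ring
  obtain ⟨k, hk⟩ := halt (2 * n - 1) (by omega)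
  rw [Nat.sub_add_cancel (by omega), ZMod.natCast_self,
    Odd.neg_one_pow ⟨n - 1, by omega⟩] at hk
  have hx₀ := hx 0
  have hy₀ := hy 0
  rw [zero_add] at hx₀ hy₀
  rw [chords_parallel_iff hx₀ hy₀, sin_eq_zero_iff]
  exact ⟨k, by linarith⟩
end

section
/- (Möbius theorem, odd case, parallel-chords form.) Let N = 2n+1 with n ≥ 1 and let x₁,…,x_N, y₁,…,y_N be real numbers such that xⱼ ≢ xⱼ₊₁ (mod 2π) and yⱼ ≢ yⱼ₊₁ (mod 2π) for j = 1,…,N−1, and x_N ≢ y₁ (mod 2π), y_N ≢ x₁ (mod 2π). Set C(θ) = (cos θ, sin θ). If for each j = 1,…,N−1 the vector C(xⱼ₊₁) − C(xⱼ) is a nonzero real scalar multiple of C(yⱼ₊₁) − C(yⱼ), then C(y₁) − C(x_N) is a nonzero real scalar multiple of C(x₁) − C(y_N). -/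
open Real

/-- A chord of the unit circle in terms of its half-difference and its midpoint angle. -/
lemma Cp_sub (a b : ℝ) :
    Cp b - Cp a = (2 * sin ((b - a) / 2)) • ((-sin ((a + b) / 2), cos ((a + b) / 2)) : ℝ × ℝ) := by
  ext
  · simp only [Cp, Prod.fst_sub, Prod.smul_fst, smul_eq_mul, cos_sub_cos, add_comm b a]
    ring
  · simp only [Cp, Prod.snd_sub, Prod.smul_snd, smul_eq_mul, sin_sub_sin, add_comm b a]

lemma modEq_two_pi_iff_sin_half_sub (a b : ℝ) :
    a ≡ b [PMOD (2 * π)] ↔ sin ((b - a) / 2) = 0 := by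
  rw [AddCommGroup.modEq_iff_zsmul', sin_eq_zero_iff]
  refine exists_congr fun k => ?_
  rw [zsmul_eq_mul]
  constructor <;> intro h <;> linarith

/-- Two nondegenerate chords of the unit circle are parallel exactly when the sums of the
angles of their endpoints agree modulo `2 * π`. -/
lemma chord_parallel_iff {a b c d : ℝ} (hab : ¬ a ≡ b [PMOD (2 * π)])
    (hcd : ¬ c ≡ d [PMOD (2 * π)]) :
    (∃ t : ℝ, t ≠ 0 ∧ Cp b - Cp a = t • (Cp d - Cp c)) ↔ c + d ≡ a + b [PMOD (2 * π)] := by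
  rw [modEq_two_pi_iff_sin_half_sub] at hab hcd ⊢
  have hsub : (a + b - (c + d)) / 2 = (a + b) / 2 - (c + d) / 2 := by ring
  rw [Cp_sub, Cp_sub, hsub]
  set m := (a + b) / 2
  set m' := (c + d) / 2
  constructor
  · rintro ⟨t, -, h⟩
    have h1 := congrArg Prod.fst h
    have h2 := congrArg Prod.snd h
    simp only [Prod.smul_fst, Prod.smul_snd, smul_eq_mul] at h1 h2
    refine (mul_eq_zero.mp ?_).resolve_left hab
    rw [sin_sub]
    linear_combination (-cos m' / 2) * h1 - sin m' / 2 * h2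
  · intro h
    have hcos : cos (m - m') ≠ 0 := fun h' => by
      have := sin_sq_add_cos_sq (m - m')
      simp [h, h'] at this
    have hm : m = m' + (m - m') := by ring
    have hs : sin m = sin m' * cos (m - m') := by
      conv_lhs => rw [hm, sin_add, h]
      ring
    have hc : cos m = cos m' * cos (m - m') := by
      conv_lhs => rw [hm, cos_add, h]
      ring
    refine ⟨sin ((b - a) / 2) / sin ((d - c) / 2) * cos (m - m'),
      mul_ne_zero (div_ne_zero hab hcd) hcos, ?_⟩
    ext
    · simp only [Prod.smul_fst, smul_eq_mul, hs]
      field_simp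
    · simp only [Prod.smul_snd, smul_eq_mul, hc]
      field_simp

/-- If consecutive terms of a sequence sum to zero modulo `p`, then its terms of even index
are all congruent to the first one. -/
lemma even_modEq_of_add_succ_modEq_zero {p : ℝ} {n : ℕ} (d : ℕ → ℝ)
    (h : ∀ j < 2 * n, d j + d (j + 1) ≡ 0 [PMOD p]) : d (2 * n) ≡ d 0 [PMOD p] := by
  induction n with
  | zero => exact AddCommGroup.modEq_refl _
  | succ n ih =>
    refine AddCommGroup.ModEq.trans ?_ (ih fun j hj => h j (by lia))
    have h1 := h (2 * n) (by lia)
    have h2 := h (2 * n + 1) (by lia)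
    rw [AddCommGroup.modEq_iff_zsmul'] at h1 h2 ⊢
    obtain ⟨k, hk⟩ := h1
    obtain ⟨l, hl⟩ := h2
    refine ⟨l - k, ?_⟩
    rw [sub_zsmul, ← hk, ← hl, show 2 * (n + 1) = 2 * n + 1 + 1 by ring]
    ring

/-- Möbius theorem (odd case) in parallel-chords form.  Here `N = 2*n+1`, and
the index `i : Fin N` represents the original index `i+1`. -/
theorem stmt_7 (n : ℕ) (hn : 1 ≤ n)
    (x y : Fin (2 * n + 1) → ℝ)
    (hx : ∀ j : Fin (2 * n), ¬ x j.castSucc ≡ x j.succ [PMOD (2 * π)])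
    (hy : ∀ j : Fin (2 * n), ¬ y j.castSucc ≡ y j.succ [PMOD (2 * π)])
    (hxy : ¬ x (Fin.last (2 * n)) ≡ y 0 [PMOD (2 * π)])
    (hyx : ¬ y (Fin.last (2 * n)) ≡ x 0 [PMOD (2 * π)])
    (hpar : ∀ j : Fin (2 * n),
      ∃ t : ℝ, t ≠ 0 ∧ Cp (x j.succ) - Cp (x j.castSucc) = t • (Cp (y j.succ) - Cp (y j.castSucc))) :
    ∃ t : ℝ, t ≠ 0 ∧
      Cp (y 0) - Cp (x (Fin.last (2 * n))) = t • (Cp (x 0) - Cp (y (Fin.last (2 * n)))) := by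
  have key := even_modEq_of_add_succ_modEq_zero (p := 2 * π) (n := n)
    (fun j => x (Fin.ofNat (2 * n + 1) j) - y (Fin.ofNat (2 * n + 1) j)) (fun j hj => by
      have h := (chord_parallel_iff (hx ⟨j, hj⟩) (hy ⟨j, hj⟩)).mp (hpar ⟨j, hj⟩)
      have e1 : Fin.ofNat (2 * n + 1) j = (⟨j, hj⟩ : Fin (2 * n)).castSucc := by
        ext; simp; lia
      have e2 : Fin.ofNat (2 * n + 1) (j + 1) = (⟨j, hj⟩ : Fin (2 * n)).succ := by
        ext; simp; lia
      rw [AddCommGroup.modEq_iff_zsmul'] at h ⊢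
      obtain ⟨k, hk⟩ := h
      refine ⟨-k, ?_⟩
      rw [neg_zsmul, ← hk, e1, e2]
      ring)
  have e0 : Fin.ofNat (2 * n + 1) 0 = 0 := rfl
  have e1 : Fin.ofNat (2 * n + 1) (2 * n) = Fin.last (2 * n) := by
    ext; simp
  rw [chord_parallel_iff hxy hyx]
  simp only [e0, e1] at key
  rw [AddCommGroup.modEq_iff_zsmul'] at key ⊢
  obtain ⟨k, hk⟩ := key
  refine ⟨-k, ?_⟩
  rw [neg_zsmul, ← hk]
  ring
end

section
/- Let x₁,…,x₅, y₁,…,y₅ be pairwise distinct elements of a field K. If (x₁,y₂,x₃,y₄) = (y₁,x₂,y₃,x₄) and (x₂,y₃,x₄,y₅) = (y₂,x₃,y₄,x₅), then (x₁,x₃,y₄,x₅) = (y₁,y₃,x₄,y₅). -/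
theorem crossRatio_ne_zero {K : Type*} [Field K] {a b c d : K}
    (hab : a ≠ b) (hbc : b ≠ c) (hcd : c ≠ d) (hda : d ≠ a) : crossRatio a b c d ≠ 0 :=
  mul_ne_zero (div_ne_zero (sub_ne_zero.2 hab) (sub_ne_zero.2 hbc))
    (div_ne_zero (sub_ne_zero.2 hcd) (sub_ne_zero.2 hda))

theorem one_sub_crossRatio_ne_zero {K : Type*} [Field K] {a b c d : K}
    (hac : a ≠ c) (hbd : b ≠ d) (hbc : b ≠ c) (hda : d ≠ a) : 1 - crossRatio a b c d ≠ 0 := by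
  rw [← sub_ne_zero] at hac hbd hbc hda
  have h : 1 - crossRatio a b c d = (a - c) * (d - b) / ((b - c) * (d - a)) := by
    unfold crossRatio
    field_simp
    ring
  rw [h]
  exact div_ne_zero (mul_ne_zero hac (by rwa [← neg_sub, neg_ne_zero])) (mul_ne_zero hbc hda)

/-- The cross-ratio of the first and the last three of five points is determined by the
cross-ratios of the first four and of the last four. -/
theorem crossRatio_mul_one_sub {K : Type*} [Field K] {a b c d e : K}
    (hbc : b ≠ c) (hcd : c ≠ d) (hda : d ≠ a) (heb : e ≠ b) (hea : e ≠ a) :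
    crossRatio a c d e * (1 - crossRatio a b c d * crossRatio b c d e) =
      crossRatio b c d e * (1 - crossRatio a b c d) := by
  rw [← sub_ne_zero] at hbc hcd hda heb hea
  unfold crossRatio
  field_simp
  ring

theorem crossRatio_eq_div {K : Type*} [Field K] {a b c d e : K}
    (hac : a ≠ c) (hbc : b ≠ c) (hbd : b ≠ d) (hcd : c ≠ d) (hda : d ≠ a) (hde : d ≠ e)
    (heb : e ≠ b) (hea : e ≠ a) :
    crossRatio a c d e = crossRatio b c d e * (1 - crossRatio a b c d) /
      (1 - crossRatio a b c d * crossRatio b c d e) := by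
  have h := crossRatio_mul_one_sub hbc hcd hda heb hea
  refine eq_div_of_mul_eq (right_ne_zero_of_mul (a := crossRatio a c d e) ?_) h
  rw [h]
  exact mul_ne_zero (crossRatio_ne_zero hbc hcd hde heb)
    (one_sub_crossRatio_ne_zero hac hbd hbc hda)

theorem stmt_8 {K : Type*} [Field K] (x₁ x₂ x₃ x₄ x₅ y₁ y₂ y₃ y₄ y₅ : K)
    (hdist : List.Pairwise (· ≠ ·) [x₁, x₂, x₃, x₄, x₅, y₁, y₂, y₃, y₄, y₅])
    (h₁ : crossRatio x₁ y₂ x₃ y₄ = crossRatio y₁ x₂ y₃ x₄)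
    (h₂ : crossRatio x₂ y₃ x₄ y₅ = crossRatio y₂ x₃ y₄ x₅) :
    crossRatio x₁ x₃ y₄ x₅ = crossRatio y₁ y₃ x₄ y₅ := by
  simp only [List.pairwise_cons, List.mem_cons, List.not_mem_nil, or_false, forall_eq_or_imp,
    forall_eq] at hdist
  rw [crossRatio_eq_div (b := y₂), crossRatio_eq_div (a := y₁) (b := x₂), h₁, h₂]
  all_goals grind
end

section
/- Let x₁,x₂,x₃,x₄,y₁,y₂,y₃,y₄ be pairwise distinct elements of a field K. Then the following three equations are pairwise equivalent: (i) (x₁,y₂,x₃,y₄) = (y₁,x₂,y₃,x₄); (ii) (x₁,x₃,y₂,y₄) = (x₄,x₂,y₃,y₁); (iii) (x₁,x₃,y₄,y₂) = (x₂,x₄,y₃,y₁). -/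
theorem crossRatio_reverse {K : Type*} [Field K] (a b c d : K) :
    crossRatio d c b a = crossRatio a b c d := by
  unfold crossRatio
  rw [← neg_sub c d, ← neg_sub b c, ← neg_sub a b, ← neg_sub d a]
  simp only [neg_div_neg_eq, div_mul_div_comm]
  congr 1
  ring

theorem crossRatio_swap_middle {K : Type*} [Field K] {a b c d : K} (hbc : b ≠ c) (had : a ≠ d) :
    crossRatio a c b d = 1 - crossRatio a b c d := by
  have h₁ := sub_ne_zero.mpr hbc
  have h₂ := sub_ne_zero.mpr had.symm
  unfold crossRatio
  rw [← neg_sub b c]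
  field_simp
  ring

theorem crossRatio_rotate_last {K : Type*} [Field K] {a b c d : K} (hab : a ≠ b) (hcd : c ≠ d) :
    crossRatio a c d b = 1 - (crossRatio a b c d)⁻¹ := by
  have h₁ := sub_ne_zero.mpr hab
  have h₂ := sub_ne_zero.mpr hcd
  unfold crossRatio
  rw [← neg_sub a b]
  simp only [mul_inv, inv_div]
  field_simp
  ring

theorem stmt_9 {K : Type*} [Field K] (x₁ x₂ x₃ x₄ y₁ y₂ y₃ y₄ : K)
    (hdist : List.Pairwise (· ≠ ·) [x₁, x₂, x₃, x₄, y₁, y₂, y₃, y₄]) :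
    (crossRatio x₁ y₂ x₃ y₄ = crossRatio y₁ x₂ y₃ x₄ ↔
      crossRatio x₁ x₃ y₂ y₄ = crossRatio x₄ x₂ y₃ y₁) ∧
    (crossRatio x₁ x₃ y₂ y₄ = crossRatio x₄ x₂ y₃ y₁ ↔
      crossRatio x₁ x₃ y₄ y₂ = crossRatio x₂ x₄ y₃ y₁) ∧
    (crossRatio x₁ y₂ x₃ y₄ = crossRatio y₁ x₂ y₃ x₄ ↔
      crossRatio x₁ x₃ y₄ y₂ = crossRatio x₂ x₄ y₃ y₁) := by
  simp only [List.pairwise_cons, List.mem_cons, forall_eq_or_imp] at hdist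
  obtain ⟨⟨-, -, -, -, hx₁y₂, -, hx₁y₄, -⟩, ⟨-, -, hx₂y₁, -, hx₂y₃, -⟩,
    ⟨-, -, hx₃y₂, -, hx₃y₄, -⟩, ⟨hx₄y₁, -, hx₄y₃, -⟩, -⟩ := hdist
  rw [← crossRatio_reverse x₄ x₂ y₃ y₁, ← crossRatio_reverse x₂ x₄ y₃ y₁,
    crossRatio_swap_middle hx₃y₂.symm hx₁y₄, crossRatio_swap_middle hx₂y₃ hx₄y₁.symm,
    crossRatio_rotate_last hx₁y₂ hx₃y₄, crossRatio_rotate_last hx₂y₁.symm hx₄y₃.symm]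
  simp only [sub_right_inj, inv_inj, and_self]
end

section
/- (Möbius theorem, even case, cross-ratio form.) Let N = 2n with n ≥ 2 and let x₁,…,x_N, y₁,…,y_N be pairwise distinct elements of a field K; set x_{N+1} = x₁ and y_{N+1} = y₁. If the equation (xⱼ, yⱼ₊₁, xⱼ₊₂, yⱼ₊₃) = (yⱼ, xⱼ₊₁, yⱼ₊₂, xⱼ₊₃) holds for all j = 1,…,N−3, then it also holds for j = N−2. -/
/-- The quadruples `(a, b, c, d)` and `(a', b', c', d')` have equal cross-ratios, with denominators
cleared. -/
def SameCrossRatio {K : Type*} [Field K] (a b c d a' b' c' d' : K) : Prop :=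
  (a - c) * (b - d) * (a' - d') * (b' - c') = (a' - c') * (b' - d') * (a - d) * (b - c)

theorem crossRatio_eq_iff_sameCrossRatio {K : Type*} [Field K] {a b c d a' b' c' d' : K}
    (h₁ : b ≠ c) (h₂ : d ≠ a) (h₃ : b' ≠ c') (h₄ : d' ≠ a') :
    crossRatio a b c d = crossRatio a' b' c' d' ↔ SameCrossRatio a b c d a' b' c' d' := by
  unfold crossRatio SameCrossRatio
  rw [div_mul_div_comm, div_mul_div_comm,
    div_eq_div_iff (mul_ne_zero (sub_ne_zero.2 h₁) (sub_ne_zero.2 h₂))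
      (mul_ne_zero (sub_ne_zero.2 h₃) (sub_ne_zero.2 h₄))]
  constructor <;> intro h
  · linear_combination -h
  · linear_combination -h

theorem SameCrossRatio.rotate {K : Type*} [Field K] {a b c d a' b' c' d' : K}
    (h : SameCrossRatio a b c d a' b' c' d') : SameCrossRatio b c d a b' c' d' a' := by
  unfold SameCrossRatio at *
  linear_combination -h

theorem SameCrossRatio.trans {K : Type*} [Field K] {a b c d e a' b' c' d' e' : K}
    (h₁ : SameCrossRatio a b c d a' b' c' d') (h₂ : SameCrossRatio b c d e b' c' d' e')
    (hbc : b ≠ c) (hbd : b ≠ d) (hbc' : b' ≠ c') (hbd' : b' ≠ d') :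
    SameCrossRatio a c d e a' c' d' e' := by
  unfold SameCrossRatio at *
  have h₃ : (b - c) * (e - d) * (b' - d') * (e' - c') =
      (b' - c') * (e' - d') * (b - d) * (e - c) := by linear_combination h₂
  have h₄ : (a - c) * (e - d) * (a' - d') * (e' - c') =
      (a' - c') * (e' - d') * (a - d) * (e - c) := by
    refine mul_left_cancel₀ (mul_ne_zero (mul_ne_zero (sub_ne_zero.2 hbc) (sub_ne_zero.2 hbd))
      (mul_ne_zero (sub_ne_zero.2 hbc') (sub_ne_zero.2 hbd'))) ?_
    linear_combination (b - c) * (e - d) * (b' - d') * (e' - c') * h₁ +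
      (a' - c') * (b' - d') * (a - d) * (b - c) * h₃
  linear_combination h₄

/-- Möbius theorem (even case) in cross-ratio form.  The relevant values are
`x 1, …, x N` and `y 1, …, y N` (`N = 2*n`), extended by the periodic
conventions `x (N+1) = x 1`, `y (N+1) = y 1`. -/
theorem stmt_10 {K : Type*} [Field K] (n : ℕ) (hn : 2 ≤ n)
    (x y : ℕ → K)
    (hxper : x (2 * n + 1) = x 1) (hyper : y (2 * n + 1) = y 1)
    (hdist : ∀ i ∈ Finset.Icc 1 (2 * n), ∀ j ∈ Finset.Icc 1 (2 * n),
      (x i = x j → i = j) ∧ (y i = y j → i = j) ∧ x i ≠ y j)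
    (heq : ∀ j, 1 ≤ j → j ≤ 2 * n - 3 →
      crossRatio (x j) (y (j + 1)) (x (j + 2)) (y (j + 3)) =
        crossRatio (y j) (x (j + 1)) (y (j + 2)) (x (j + 3))) :
    crossRatio (x (2 * n - 2)) (y (2 * n - 1)) (x (2 * n)) (y (2 * n + 1)) =
      crossRatio (y (2 * n - 2)) (x (2 * n - 1)) (y (2 * n)) (x (2 * n + 1)) := by
  have hx : ∀ i j, 1 ≤ i → i < j → j ≤ 2 * n → x i ≠ x j := fun i j hi hij hj h =>
    hij.ne ((hdist i (by simp; omega) j (by simp; omega)).1 h)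
  have hy : ∀ i j, 1 ≤ i → i < j → j ≤ 2 * n → y i ≠ y j := fun i j hi hij hj h =>
    hij.ne ((hdist i (by simp; omega) j (by simp; omega)).2.1 h)
  have hxy : ∀ i j, 1 ≤ i → i ≤ 2 * n → 1 ≤ j → j ≤ 2 * n → x i ≠ y j :=
    fun i j hi hi' hj hj' => (hdist i (by simp; omega) j (by simp; omega)).2.2
  -- Exchanging `x` and `y` at the even indices turns the equations into the assertion that
  -- `u` and `v` have the same cross-ratios.
  let u : ℕ → K := fun j => if Even j then y j else x j
  let v : ℕ → K := fun j => if Even j then x j else y j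
  have hu : ∀ i j, 1 ≤ i → i < j → j ≤ 2 * n → u i ≠ u j := by
    intro i j hi hij hj
    have := hxy j i (by omega) hj hi (by omega)
    have := hxy i j hi (by omega) (by omega) hj
    have := hx i j hi hij hj
    have := hy i j hi hij hj
    grind
  have hv : ∀ i j, 1 ≤ i → i < j → j ≤ 2 * n → v i ≠ v j := by
    intro i j hi hij hj
    have := hxy j i (by omega) hj hi (by omega)
    have := hxy i j hi (by omega) (by omega) hj
    have := hx i j hi hij hj
    have := hy i j hi hij hj
    grind
  have hcons : ∀ j, 1 ≤ j → j + 3 ≤ 2 * n →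
      SameCrossRatio (u j) (u (j + 1)) (u (j + 2)) (u (j + 3))
        (v j) (v (j + 1)) (v (j + 2)) (v (j + 3)) := by
    intro j hj hj'
    rw [← crossRatio_eq_iff_sameCrossRatio
      (hu _ _ (by omega) (by omega) (by omega)) (hu _ _ (by omega) (by omega) (by omega)).symm
      (hv _ _ (by omega) (by omega) (by omega)) (hv _ _ (by omega) (by omega) (by omega)).symm]
    have h := heq j hj (by omega)
    by_cases hj₂ : Even j
    · simpa [u, v, hj₂, parity_simps, show ¬ Even 3 by decide] using h.symm
    · simpa [u, v, hj₂, parity_simps, show ¬ Even 3 by decide] using h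
  have hfirst : ∀ k, 2 ≤ k → k + 2 ≤ 2 * n →
      SameCrossRatio (u 1) (u k) (u (k + 1)) (u (k + 2))
        (v 1) (v k) (v (k + 1)) (v (k + 2)) := by
    intro k hk
    induction k, hk using Nat.le_induction with
    | base => exact fun h => hcons 1 le_rfl h
    | succ k hk ih =>
      intro h
      exact (ih (by omega)).trans (hcons k (by omega) (by omega))
        (hu _ _ (by omega) (by omega) (by omega)) (hu _ _ (by omega) (by omega) (by omega))
        (hv _ _ (by omega) (by omega) (by omega)) (hv _ _ (by omega) (by omega) (by omega))
  obtain ⟨m, rfl⟩ : ∃ m, n = m + 2 := ⟨n - 2, by omega⟩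
  have hlast := (hfirst (2 * m + 2) (by omega) (by omega)).rotate
  rw [← crossRatio_eq_iff_sameCrossRatio
    (hu _ _ (by omega) (by omega) (by omega)) (hu _ _ (by omega) (by omega) (by omega))
    (hv _ _ (by omega) (by omega) (by omega)) (hv _ _ (by omega) (by omega) (by omega))] at hlast
  rw [hxper, hyper]
  simpa [u, v, parity_simps, show ¬ Even 3 by decide, mul_add] using hlast.symm
end

section
/- (Möbius theorem, odd case, cross-ratio form.) Let N = 2n+1 with n ≥ 2 and let x₁,…,x_N, y₁,…,y_N be pairwise distinct elements of a field K; set x_{N+1} = y₁ and y_{N+1} = x₁. If the equation (xⱼ, yⱼ₊₁, xⱼ₊₂, yⱼ₊₃) = (yⱼ, xⱼ₊₁, yⱼ₊₂, xⱼ₊₃) holds for all j = 1,…,N−3, then it also holds for j = N−2. -/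
/-- Cross-ratio equality with the denominators cleared. -/
theorem crossRatio_eq_iff {K : Type*} [Field K] {a b c d a' b' c' d' : K}
    (hbc : b ≠ c) (hda : d ≠ a) (hbc' : b' ≠ c') (hda' : d' ≠ a') :
    crossRatio a b c d = crossRatio a' b' c' d' ↔
      (a - b) * (c - d) * ((b' - c') * (d' - a')) =
        (a' - b') * (c' - d') * ((b - c) * (d - a)) := by
  unfold crossRatio
  rw [div_mul_div_comm, div_mul_div_comm, div_eq_div_iff]
  · exact mul_ne_zero (sub_ne_zero.2 hbc) (sub_ne_zero.2 hda)
  · exact mul_ne_zero (sub_ne_zero.2 hbc') (sub_ne_zero.2 hda')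

/-- The Möbius transformation `z ↦ (p * z + q) / (r * z + s)` is nondegenerate and maps `z`
to `w`, with both values finite. -/
def MobiusMaps {K : Type*} [Field K] (p q r s z w : K) : Prop :=
  p * s - q * r ≠ 0 ∧ w * (r * z + s) = p * z + q

namespace MobiusMaps

variable {K : Type*} [Field K] {p q r s z w z' w' : K}

theorem denom_ne_zero (h : MobiusMaps p q r s z w) : r * z + s ≠ 0 := by
  obtain ⟨hdet, hw⟩ := h
  intro h0
  have h1 : p * z + q = 0 := by rw [← hw, h0, mul_zero]
  exact hdet (by linear_combination p * h0 - r * h1)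

theorem sub_mul (h : MobiusMaps p q r s z w) (h' : MobiusMaps p q r s z' w') :
    (w - w') * ((r * z + s) * (r * z' + s)) = (p * s - q * r) * (z - z') := by
  linear_combination (r * z' + s) * h.2 - (r * z + s) * h'.2

end MobiusMaps

/-- Möbius transformations preserve the cross-ratio. -/
theorem crossRatio_eq_of_mobiusMaps {K : Type*} [Field K] {p q r s a b c d a' b' c' d' : K}
    (ha : MobiusMaps p q r s a a') (hb : MobiusMaps p q r s b b')
    (hc : MobiusMaps p q r s c c') (hd : MobiusMaps p q r s d d')
    (hbc : b ≠ c) (hda : d ≠ a) (hbc' : b' ≠ c') (hda' : d' ≠ a') :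
    crossRatio a b c d = crossRatio a' b' c' d' := by
  rw [crossRatio_eq_iff hbc hda hbc' hda']
  have key : ∀ {z w z' w'}, MobiusMaps p q r s z w → MobiusMaps p q r s z' w' →
      w - w' = (p * s - q * r) * (z - z') / ((r * z + s) * (r * z' + s)) := fun h h' =>
    eq_div_of_mul_eq (mul_ne_zero h.denom_ne_zero h'.denom_ne_zero) (h.sub_mul h')
  rw [key ha hb, key hc hd, key hb hc, key hd ha]
  generalize r * a + s = A, r * b + s = B, r * c + s = C, r * d + s = D
  ring

/-- A Möbius transformation matching three points of two quadruples of equal cross-ratio also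
matches the fourth. -/
theorem mobiusMaps_of_crossRatio_eq {K : Type*} [Field K] {p q r s a b c d a' b' c' d' : K}
    (ha : MobiusMaps p q r s a a') (hb : MobiusMaps p q r s b b')
    (hc : MobiusMaps p q r s c c')
    (hab : a ≠ b) (hac : a ≠ c) (hbc : b ≠ c) (hda : d ≠ a) (hbc' : b' ≠ c') (hda' : d' ≠ a')
    (h : crossRatio a b c d = crossRatio a' b' c' d') :
    MobiusMaps p q r s d d' := by
  rw [crossRatio_eq_iff hbc hda hbc' hda'] at h
  refine ⟨ha.1, ?_⟩
  have hne : (p * s - q * r) * (a - b) * (b - c) * (a - c) ≠ 0 :=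
    mul_ne_zero (mul_ne_zero (mul_ne_zero ha.1 (sub_ne_zero.2 hab)) (sub_ne_zero.2 hbc))
      (sub_ne_zero.2 hac)
  have h1 := ha.sub_mul hb
  have h2 := hb.sub_mul hc
  have h3 : (p * s - q * r) * (a - b) * (b - c) *
      ((c - d) * (r * a + s) * (d' - a') - (c' - d') * (r * c + s) * (d - a)) = 0 := by
    linear_combination (r * a + s) * (r * b + s) * (r * c + s) * h
      - (a - b) * (c - d) * (r * a + s) * (d' - a') * h2
      + (c' - d') * (r * c + s) * (b - c) * (d - a) * h1
  apply mul_left_cancel₀ hne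
  linear_combination -h3 + (p * s - q * r) * (a - b) * (b - c) *
    (-(c - d) * ha.2 - (d - a) * hc.2)

/-- Some Möbius transformation maps three given distinct points to three given distinct points. -/
theorem exists_mobiusMaps {K : Type*} [Field K] {a b c a' b' c' : K}
    (hab : a ≠ b) (hac : a ≠ c) (hbc : b ≠ c) (hab' : a' ≠ b') (hac' : a' ≠ c') (hbc' : b' ≠ c') :
    ∃ p q r s : K, MobiusMaps p q r s a a' ∧ MobiusMaps p q r s b b' ∧
      MobiusMaps p q r s c c' := by
  obtain ⟨A, hA⟩ : ∃ A, A = (a - b) * (b' - c') := ⟨_, rfl⟩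
  obtain ⟨B, hB⟩ : ∃ B, B = (a' - b') * (b - c) := ⟨_, rfl⟩
  have hdet : (B * c' - A * a') * (A * c - B * a) - (A * a' * c - B * c' * a) * (B - A) ≠ 0 := by
    have : (B * c' - A * a') * (A * c - B * a) - (A * a' * c - B * c' * a) * (B - A) =
        A * B * (a - c) * (a' - c') := by ring
    rw [this, hA, hB]
    simp [sub_eq_zero, *]
  refine ⟨B * c' - A * a', A * a' * c - B * c' * a, B - A, A * c - B * a,
    ⟨hdet, ?_⟩, ⟨hdet, ?_⟩, ⟨hdet, ?_⟩⟩
  · ring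
  · rw [hA, hB]; ring
  · ring

/-- Sequences of distinct points with equal consecutive cross-ratios are related by a Möbius
transformation. -/
theorem exists_mobiusMaps_of_crossRatio_eq {K : Type*} [Field K] {u v : ℕ → K} {N : ℕ}
    (hN : 3 ≤ N) (hu : Set.InjOn u (Set.Icc 1 N)) (hv : Set.InjOn v (Set.Icc 1 N))
    (h : ∀ j, 1 ≤ j → j + 3 ≤ N →
      crossRatio (u j) (u (j + 1)) (u (j + 2)) (u (j + 3)) =
        crossRatio (v j) (v (j + 1)) (v (j + 2)) (v (j + 3))) :
    ∃ p q r s : K, ∀ i, 1 ≤ i → i ≤ N → MobiusMaps p q r s (u i) (v i) := by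
  have hu' : ∀ i j, 1 ≤ i → i ≤ N → 1 ≤ j → j ≤ N → i ≠ j → u i ≠ u j :=
    fun i j hi hi' hj hj' => hu.ne ⟨hi, hi'⟩ ⟨hj, hj'⟩
  have hv' : ∀ i j, 1 ≤ i → i ≤ N → 1 ≤ j → j ≤ N → i ≠ j → v i ≠ v j :=
    fun i j hi hi' hj hj' => hv.ne ⟨hi, hi'⟩ ⟨hj, hj'⟩
  obtain ⟨p, q, r, s, h1, h2, h3⟩ := exists_mobiusMaps
    (hu' 1 2 (by lia) (by lia) (by lia) (by lia) (by lia))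
    (hu' 1 3 (by lia) (by lia) (by lia) (by lia) (by lia))
    (hu' 2 3 (by lia) (by lia) (by lia) (by lia) (by lia))
    (hv' 1 2 (by lia) (by lia) (by lia) (by lia) (by lia))
    (hv' 1 3 (by lia) (by lia) (by lia) (by lia) (by lia))
    (hv' 2 3 (by lia) (by lia) (by lia) (by lia) (by lia))
  refine ⟨p, q, r, s, fun i => ?_⟩
  induction i using Nat.strong_induction_on with
  | _ i ih =>
    intro hi hiN
    obtain rfl | rfl | rfl | hi4 : i = 1 ∨ i = 2 ∨ i = 3 ∨ 4 ≤ i := by lia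
    · exact h1
    · exact h2
    · exact h3
    · obtain ⟨j, rfl⟩ : ∃ j, i = j + 3 := ⟨i - 3, by lia⟩
      exact mobiusMaps_of_crossRatio_eq (ih j (by lia) (by lia) (by lia))
        (ih (j + 1) (by lia) (by lia) (by lia)) (ih (j + 2) (by lia) (by lia) (by lia))
        (hu' _ _ (by lia) (by lia) (by lia) (by lia) (by lia))
        (hu' _ _ (by lia) (by lia) (by lia) (by lia) (by lia))
        (hu' _ _ (by lia) (by lia) (by lia) (by lia) (by lia))
        (hu' _ _ (by lia) (by lia) (by lia) (by lia) (by lia))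
        (hv' _ _ (by lia) (by lia) (by lia) (by lia) (by lia))
        (hv' _ _ (by lia) (by lia) (by lia) (by lia) (by lia))
        (h j (by lia) hiN)

/-- The sequence equal to `x` at odd indices and to `y` at even indices. -/
def interlace {K : Type*} (x y : ℕ → K) (i : ℕ) : K :=
  if Even i then y i else x i

theorem interlace_of_even {K : Type*} (x y : ℕ → K) {i : ℕ} (hi : Even i) :
    interlace x y i = y i :=
  if_pos hi

theorem interlace_of_odd {K : Type*} (x y : ℕ → K) {i : ℕ} (hi : Odd i) :
    interlace x y i = x i :=
  if_neg (Nat.not_even_iff_odd.2 hi)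

theorem injOn_interlace {K : Type*} {x y : ℕ → K} {s : Set ℕ} (hx : Set.InjOn x s)
    (hy : Set.InjOn y s) (hxy : ∀ i ∈ s, ∀ j ∈ s, x i ≠ y j) :
    Set.InjOn (interlace x y) s := by
  intro i hi j hj h
  unfold interlace at h
  split_ifs at h
  · exact hy hi hj h
  · exact absurd h.symm (hxy j hj i hi)
  · exact absurd h (hxy i hi j hj)
  · exact hx hi hj h

/-- Möbius theorem (odd case) in cross-ratio form.  The relevant values are
`x 1, …, x N` and `y 1, …, y N` (`N = 2*n+1`), extended by the twisted
conventions `x (N+1) = y 1`, `y (N+1) = x 1`. -/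
theorem stmt_11 {K : Type*} [Field K] (n : ℕ) (hn : 2 ≤ n)
    (x y : ℕ → K)
    (hxper : x (2 * n + 1 + 1) = y 1) (hyper : y (2 * n + 1 + 1) = x 1)
    (hdist : ∀ i ∈ Finset.Icc 1 (2 * n + 1), ∀ j ∈ Finset.Icc 1 (2 * n + 1),
      (x i = x j → i = j) ∧ (y i = y j → i = j) ∧ x i ≠ y j)
    (heq : ∀ j, 1 ≤ j → j ≤ 2 * n + 1 - 3 →
      crossRatio (x j) (y (j + 1)) (x (j + 2)) (y (j + 3)) =
        crossRatio (y j) (x (j + 1)) (y (j + 2)) (x (j + 3))) :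
    crossRatio (x (2 * n - 1)) (y (2 * n)) (x (2 * n + 1)) (y (2 * n + 2)) =
      crossRatio (y (2 * n - 1)) (x (2 * n)) (y (2 * n + 1)) (x (2 * n + 2)) := by
  have hx : Set.InjOn x (Set.Icc 1 (2 * n + 1)) := fun i hi j hj =>
    (hdist i (Finset.mem_Icc.2 hi) j (Finset.mem_Icc.2 hj)).1
  have hy : Set.InjOn y (Set.Icc 1 (2 * n + 1)) := fun i hi j hj =>
    (hdist i (Finset.mem_Icc.2 hi) j (Finset.mem_Icc.2 hj)).2.1
  have hxy : ∀ i ∈ Set.Icc 1 (2 * n + 1), ∀ j ∈ Set.Icc 1 (2 * n + 1), x i ≠ y j :=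
    fun i hi j hj => (hdist i (Finset.mem_Icc.2 hi) j (Finset.mem_Icc.2 hj)).2.2
  have hu := injOn_interlace hx hy hxy
  have hv := injOn_interlace hy hx fun i hi j hj => (hxy j hj i hi).symm
  obtain ⟨p, q, r, s, hM⟩ := exists_mobiusMaps_of_crossRatio_eq (by lia) hu hv fun j hj hj' => by
    have hj3 := heq j hj (by lia)
    rcases Nat.even_or_odd j with he | ho
    · have e1 : Odd (j + 1) := he.add_one
      have e2 : Even (j + 2) := e1.add_one
      have e3 : Odd (j + 3) := e2.add_one
      simpa only [interlace_of_even _ _ he, interlace_of_odd _ _ e1, interlace_of_even _ _ e2,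
        interlace_of_odd _ _ e3] using hj3.symm
    · have e1 : Even (j + 1) := ho.add_one
      have e2 : Odd (j + 2) := e1.add_one
      have e3 : Even (j + 3) := e2.add_one
      simpa only [interlace_of_odd _ _ ho, interlace_of_even _ _ e1, interlace_of_odd _ _ e2,
        interlace_of_even _ _ e3] using hj3
  have ha := hM (2 * n - 1) (by lia) (by lia)
  have hb := hM (2 * n) (by lia) (by lia)
  have hc := hM (2 * n + 1) (by lia) (by lia)
  have hd := hM 1 (by lia) (by lia)
  have hodd : Odd (2 * n - 1) := ⟨n - 1, by lia⟩
  simp only [interlace_of_odd _ _ hodd, interlace_of_even _ _ (even_two_mul n),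
    interlace_of_odd _ _ (odd_two_mul_add_one n), interlace_of_odd _ _ odd_one] at ha hb hc hd
  rw [hxper, hyper]
  exact crossRatio_eq_of_mobiusMaps ha hb hc hd
    (hxy _ ⟨by lia, by lia⟩ _ ⟨by lia, by lia⟩).symm
    (hx.ne ⟨by lia, by lia⟩ ⟨by lia, by lia⟩ (by lia))
    (hxy _ ⟨by lia, by lia⟩ _ ⟨by lia, by lia⟩)
    (hy.ne ⟨by lia, by lia⟩ ⟨by lia, by lia⟩ (by lia))
end

section
/- (Quadrilateral-lattice incidence theorem in the plane.) Let X, X₁, X₂, X₃, X₁₂, X₁₃, X₂₃, X₁₂₃ be eight points of ℝ² such that no three of them are collinear. Suppose the following twelve points exist, each lying on the two indicated affine lines: A³₁ on XX₁ and X₃X₁₃; A³₂ on XX₂ and X₃X₂₃; A³₁₂ on X₂X₁₂ and X₂₃X₁₂₃; A³₂₁ on X₁X₁₂ and X₁₃X₁₂₃; A¹₂ on XX₂ and X₁X₁₂; A¹₃ on XX₃ and X₁X₁₃; A¹₂₃ on X₃X₂₃ and X₁₃X₁₂₃; A¹₃₂ on X₂X₂₃ and X₁₂X₁₂₃; A²₁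 on XX₁ and X₂X₁₂; A²₃ on XX₃ and X₂X₂₃; A²₁₃ on X₃X₁₃ and X₂₃X₁₂₃; A²₃₁ on X₁X₁₃ and X₁₂X₁₂₃. If the four points A³₁, A³₂, A³₁₂, A³₂₁ are collinear, then the four points A¹₂, A¹₃, A¹₂₃, A¹₃₂ are collinear and the four points A²₁, A²₃, A²₁₃, A²₃₁ are collinear. -/
section PlaneIncidence

variable {V : Type*} [AddCommGroup V] [Module ℝ V]

theorem AffineMap.eq_on_line {f g : V →ᵃ[ℝ] ℝ} {P Q A : V} (hA : A ∈ line[ℝ, P, Q])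
    (hP : f P = g P) (hQ : f Q = g Q) : f A = g A := by
  obtain ⟨r, rfl⟩ := mem_affineSpan_pair_iff_exists_lineMap_eq.1 hA
  simp only [AffineMap.apply_lineMap, hP, hQ]

theorem AffineMap.eq_zero_of_mem_line {f : V →ᵃ[ℝ] ℝ} {P Q A : V} (hA : A ∈ line[ℝ, P, Q])
    (hAP : A ≠ P) (hP : f P = 0) (hfA : f A = 0) : f Q = 0 := by
  obtain ⟨r, rfl⟩ := mem_affineSpan_pair_iff_exists_lineMap_eq.1 hA
  have hr : r ≠ 0 := by
    rintro rfl
    simp at hAP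
  rw [AffineMap.apply_lineMap, hP] at hfA
  simpa [AffineMap.lineMap_apply, hr] using hfA

variable [FiniteDimensional ℝ V]

theorem exists_affineMap_of_not_collinear (hV : Module.finrank ℝ V = 2) {P Q R : V}
    (h : ¬ Collinear ℝ ({P, Q, R} : Set V)) (a b c : ℝ) :
    ∃ f : V →ᵃ[ℝ] ℝ, f P = a ∧ f Q = b ∧ f R = c := by
  have hind := affineIndependent_iff_not_collinear_set.2 h
  let B : AffineBasis (Fin 3) ℝ V :=
    ⟨![P, Q, R], hind, hind.affineSpan_eq_top_iff_card_eq_finrank_add_one.2 (by simp [hV])⟩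
  have h0 : B 0 = P := rfl
  have h1 : B 1 = Q := rfl
  have h2 : B 2 = R := rfl
  refine ⟨a • B.coord 0 + b • B.coord 1 + c • B.coord 2, ?_, ?_, ?_⟩
  · simp [← h0, B.coord_apply]
  · simp [← h1, B.coord_apply]
  · simp [← h2, B.coord_apply]

theorem collinear_of_affineMap_eq_zero (hV : Module.finrank ℝ V = 2) {f : V →ᵃ[ℝ] ℝ}
    (hf : f ≠ 0) {s : Set V} (hs : ∀ p ∈ s, f p = 0) : Collinear ℝ s := by
  rcases s.eq_empty_or_nonempty with rfl | ⟨p₀, hp₀⟩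
  · exact collinear_empty ℝ V
  have hlin : f.linear ≠ 0 := by
    intro h
    apply hf
    ext p
    have := f.linearMap_vsub p p₀
    rw [h, hs p₀ hp₀] at this
    simpa using this.symm
  have hle : vectorSpan ℝ s ≤ LinearMap.ker f.linear := by
    rw [vectorSpan_def, Submodule.span_le]
    rintro _ ⟨p, hp, q, hq, rfl⟩
    have := f.linearMap_vsub p q
    rw [hs p hp, hs q hq] at this
    simpa using this
  have hker := Module.Dual.finrank_ker_add_one_of_ne_zero hlin
  have hmono := Submodule.finrank_mono hle
  rw [collinear_iff_finrank_le_one]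
  omega

theorem AffineMap.ext_of_not_collinear (hV : Module.finrank ℝ V = 2) {f g : V →ᵃ[ℝ] ℝ}
    {P Q R : V} (h : ¬ Collinear ℝ ({P, Q, R} : Set V))
    (hP : f P = g P) (hQ : f Q = g Q) (hR : f R = g R) : f = g := by
  by_contra hne
  exact h (collinear_of_affineMap_eq_zero hV (sub_ne_zero.2 hne) (by simp [hP, hQ, hR]))

theorem Collinear.exists_affineMap_eq_zero (hV : Module.finrank ℝ V = 2) {s : Set V}
    (hs : Collinear ℝ s) : ∃ f : V →ᵃ[ℝ] ℝ, f ≠ 0 ∧ ∀ p ∈ s, f p = 0 := by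
  rcases s.eq_empty_or_nonempty with rfl | ⟨p₀, hp₀⟩
  · exact ⟨AffineMap.const ℝ V 1, fun h => by simpa using congrArg (fun f => f 0) h, by simp⟩
  have hlt : vectorSpan ℝ s < ⊤ := by
    rw [lt_top_iff_ne_top]
    intro h
    have := collinear_iff_finrank_le_one.1 hs
    rw [h, finrank_top] at this
    omega
  obtain ⟨φ, hφ, hle⟩ := Submodule.exists_le_ker_of_lt_top _ hlt
  refine ⟨φ.toAffineMap - AffineMap.const ℝ V (φ p₀), ?_, fun p hp => ?_⟩
  · intro h
    apply hφ
    simpa using congrArg AffineMap.linear h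
  · have : φ (p -ᵥ p₀) = 0 := hle (vsub_mem_vectorSpan ℝ hp hp₀)
    simpa using this

/-- If corresponding edges `PP'` and `QQ'` meet on the zero line of `l`, then lifting `P`, `P'` to
height `l` and `Q`, `Q'` to height `0` gives four coplanar points. -/
theorem exists_affineMap_of_edges_meet (hV : Module.finrank ℝ V = 2) {l : V →ᵃ[ℝ] ℝ}
    {P P' Q Q' A : V} (hAP : A ∈ line[ℝ, P, P']) (hAQ : A ∈ line[ℝ, Q, Q']) (hA : l A = 0)
    (h : ¬ Collinear ℝ ({P, P', Q} : Set V)) :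
    ∃ f : V →ᵃ[ℝ] ℝ, f P = l P ∧ f P' = l P' ∧ f Q = 0 ∧ f Q' = 0 := by
  obtain ⟨f, hP, hP', hQ⟩ := exists_affineMap_of_not_collinear hV h (l P) (l P') 0
  refine ⟨f, hP, hP', hQ, AffineMap.eq_zero_of_mem_line hAQ ?_ hQ
    ((AffineMap.eq_on_line hAP hP hP').trans hA)⟩
  rintro rfl
  apply h
  rw [Set.pair_comm, Set.insert_comm]
  exact collinear_insert_of_mem_affineSpan_pair hAP

/-- The incidence theorem for one of the two remaining pairs of opposite faces: the cube is lifted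
to a hexahedron with planar faces in space, and the `A`-points lie over the intersection line of
two opposite face planes. -/
theorem collinear_opposite_faces (hV : Module.finrank ℝ V = 2)
    {X X₁ X₂ X₃ X₁₂ X₁₃ X₂₃ X₁₂₃ A3₁ A3₂ A3₁₂ A3₂₁ A1₂ A1₃ A1₂₃ A1₃₂ : V}
    (h₁ : ¬ Collinear ℝ ({X, X₁, X₃} : Set V)) (h₂ : ¬ Collinear ℝ ({X, X₂, X₃} : Set V))
    (h₁' : ¬ Collinear ℝ ({X₂, X₁₂, X₂₃} : Set V))
    (h₂' : ¬ Collinear ℝ ({X₁, X₁₂, X₁₃} : Set V))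
    (h₃ : ¬ Collinear ℝ ({X, X₁, X₂} : Set V)) (h₃' : ¬ Collinear ℝ ({X₃, X₁₃, X₂₃} : Set V))
    (hA3₁ : A3₁ ∈ line[ℝ, X, X₁] ∧ A3₁ ∈ line[ℝ, X₃, X₁₃])
    (hA3₂ : A3₂ ∈ line[ℝ, X, X₂] ∧ A3₂ ∈ line[ℝ, X₃, X₂₃])
    (hA3₁₂ : A3₁₂ ∈ line[ℝ, X₂, X₁₂] ∧ A3₁₂ ∈ line[ℝ, X₂₃, X₁₂₃])
    (hA3₂₁ : A3₂₁ ∈ line[ℝ, X₁, X₁₂] ∧ A3₂₁ ∈ line[ℝ, X₁₃, X₁₂₃])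
    (hA1₂ : A1₂ ∈ line[ℝ, X, X₂] ∧ A1₂ ∈ line[ℝ, X₁, X₁₂])
    (hA1₃ : A1₃ ∈ line[ℝ, X, X₃] ∧ A1₃ ∈ line[ℝ, X₁, X₁₃])
    (hA1₂₃ : A1₂₃ ∈ line[ℝ, X₃, X₂₃] ∧ A1₂₃ ∈ line[ℝ, X₁₃, X₁₂₃])
    (hA1₃₂ : A1₃₂ ∈ line[ℝ, X₂, X₂₃] ∧ A1₃₂ ∈ line[ℝ, X₁₂, X₁₂₃])
    (hcol : Collinear ℝ ({A3₁, A3₂, A3₁₂, A3₂₁} : Set V)) :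
    Collinear ℝ ({A1₂, A1₃, A1₂₃, A1₃₂} : Set V) := by
  obtain ⟨l, hl, hlA⟩ := hcol.exists_affineMap_eq_zero hV
  obtain ⟨g, gX, gX₂, gX₃, gX₂₃⟩ :=
    exists_affineMap_of_edges_meet hV hA3₂.1 hA3₂.2 (hlA _ (by simp)) h₂
  obtain ⟨h, hX₁, hX₁₂, hX₁₃, hX₁₂₃⟩ :=
    exists_affineMap_of_edges_meet hV hA3₂₁.1 hA3₂₁.2 (hlA _ (by simp)) h₂'
  obtain ⟨k, kX, kX₁, kX₃, kX₁₃⟩ :=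
    exists_affineMap_of_edges_meet hV hA3₁.1 hA3₁.2 (hlA _ (by simp)) h₁
  obtain ⟨m, mX₂, mX₁₂, mX₂₃, mX₁₂₃⟩ :=
    exists_affineMap_of_edges_meet hV hA3₁₂.1 hA3₁₂.2 (hlA _ (by simp)) h₁'
  have hne : g ≠ h := by
    rintro rfl
    have hgl : g = l := AffineMap.ext_of_not_collinear hV h₃ gX hX₁ gX₂
    have hg0 : g = 0 := AffineMap.ext_of_not_collinear hV h₃' gX₃ hX₁₃ gX₂₃
    exact hl (hgl.symm.trans hg0)
  have e₂ : g A1₂ = h A1₂ :=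
    (AffineMap.eq_on_line hA1₂.1 gX gX₂).trans (AffineMap.eq_on_line hA1₂.2 hX₁ hX₁₂).symm
  have e₃ : g A1₃ = h A1₃ :=
    (AffineMap.eq_on_line hA1₃.1 (gX.trans kX.symm) (gX₃.trans kX₃.symm)).trans
      (AffineMap.eq_on_line hA1₃.2 (hX₁.trans kX₁.symm) (hX₁₃.trans kX₁₃.symm)).symm
  have e₂₃ : g A1₂₃ = h A1₂₃ :=
    (AffineMap.eq_on_line (g := 0) hA1₂₃.1 gX₃ gX₂₃).trans
      (AffineMap.eq_on_line (g := 0) hA1₂₃.2 hX₁₃ hX₁₂₃).symm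
  have e₃₂ : g A1₃₂ = h A1₃₂ :=
    (AffineMap.eq_on_line hA1₃₂.1 (gX₂.trans mX₂.symm) (gX₂₃.trans mX₂₃.symm)).trans
      (AffineMap.eq_on_line hA1₃₂.2 (hX₁₂.trans mX₁₂.symm) (hX₁₂₃.trans mX₁₂₃.symm)).symm
  exact collinear_of_affineMap_eq_zero hV (sub_ne_zero.2 hne) (by simp [e₂, e₃, e₂₃, e₃₂])

end PlaneIncidence


/-- Quadrilateral-lattice incidence theorem in the plane: for a combinatorial
cube drawn in ℝ² in general position, if the intersection points of the
corresponding edges of one pair of opposite faces are collinear, then the same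
holds for the other two pairs. -/
theorem stmt_13 (X X₁ X₂ X₃ X₁₂ X₁₃ X₂₃ X₁₂₃ : ℝ × ℝ)
    (hdist : List.Pairwise (· ≠ ·) [X, X₁, X₂, X₃, X₁₂, X₁₃, X₂₃, X₁₂₃])
    (hgen : ∀ P Q R : ℝ × ℝ,
      P ∈ ({X, X₁, X₂, X₃, X₁₂, X₁₃, X₂₃, X₁₂₃} : Set (ℝ × ℝ)) →
      Q ∈ ({X, X₁, X₂, X₃, X₁₂, X₁₃, X₂₃, X₁₂₃} : Set (ℝ × ℝ)) →
      R ∈ ({X, X₁, X₂, X₃, X₁₂, X₁₃, X₂₃, X₁₂₃} : Set (ℝ × ℝ)) →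
      P ≠ Q → P ≠ R → Q ≠ R → ¬ Collinear ℝ ({P, Q, R} : Set (ℝ × ℝ)))
    (A3₁ A3₂ A3₁₂ A3₂₁ A1₂ A1₃ A1₂₃ A1₃₂ A2₁ A2₃ A2₁₃ A2₃₁ : ℝ × ℝ)
    (hA3₁ : A3₁ ∈ line[ℝ, X, X₁] ∧ A3₁ ∈ line[ℝ, X₃, X₁₃])
    (hA3₂ : A3₂ ∈ line[ℝ, X, X₂] ∧ A3₂ ∈ line[ℝ, X₃, X₂₃])
    (hA3₁₂ : A3₁₂ ∈ line[ℝ, X₂, X₁₂] ∧ A3₁₂ ∈ line[ℝ, X₂₃, X₁₂₃])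
    (hA3₂₁ : A3₂₁ ∈ line[ℝ, X₁, X₁₂] ∧ A3₂₁ ∈ line[ℝ, X₁₃, X₁₂₃])
    (hA1₂ : A1₂ ∈ line[ℝ, X, X₂] ∧ A1₂ ∈ line[ℝ, X₁, X₁₂])
    (hA1₃ : A1₃ ∈ line[ℝ, X, X₃] ∧ A1₃ ∈ line[ℝ, X₁, X₁₃])
    (hA1₂₃ : A1₂₃ ∈ line[ℝ, X₃, X₂₃] ∧ A1₂₃ ∈ line[ℝ, X₁₃, X₁₂₃])
    (hA1₃₂ : A1₃₂ ∈ line[ℝ, X₂, X₂₃] ∧ A1₃₂ ∈ line[ℝ, X₁₂, X₁₂₃])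
    (hA2₁ : A2₁ ∈ line[ℝ, X, X₁] ∧ A2₁ ∈ line[ℝ, X₂, X₁₂])
    (hA2₃ : A2₃ ∈ line[ℝ, X, X₃] ∧ A2₃ ∈ line[ℝ, X₂, X₂₃])
    (hA2₁₃ : A2₁₃ ∈ line[ℝ, X₃, X₁₃] ∧ A2₁₃ ∈ line[ℝ, X₂₃, X₁₂₃])
    (hA2₃₁ : A2₃₁ ∈ line[ℝ, X₁, X₁₃] ∧ A2₃₁ ∈ line[ℝ, X₁₂, X₁₂₃])
    (hcol3 : Collinear ℝ ({A3₁, A3₂, A3₁₂, A3₂₁} : Set (ℝ × ℝ))) :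
    Collinear ℝ ({A1₂, A1₃, A1₂₃, A1₃₂} : Set (ℝ × ℝ)) ∧
      Collinear ℝ ({A2₁, A2₃, A2₁₃, A2₃₁} : Set (ℝ × ℝ)) := by
  have hV : Module.finrank ℝ (ℝ × ℝ) = 2 := by simp
  simp only [List.pairwise_cons, List.mem_cons, List.not_mem_nil, or_false, forall_eq_or_imp,
    forall_eq] at hdist
  have h₁ := hgen X X₁ X₃ (by simp) (by simp) (by simp) (by tauto) (by tauto) (by tauto)
  have h₂ := hgen X X₂ X₃ (by simp) (by simp) (by simp) (by tauto) (by tauto) (by tauto)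
  have h₁' := hgen X₂ X₁₂ X₂₃ (by simp) (by simp) (by simp) (by tauto) (by tauto) (by tauto)
  have h₂' := hgen X₁ X₁₂ X₁₃ (by simp) (by simp) (by simp) (by tauto) (by tauto) (by tauto)
  have h₃ := hgen X X₁ X₂ (by simp) (by simp) (by simp) (by tauto) (by tauto) (by tauto)
  have h₃' := hgen X₃ X₁₃ X₂₃ (by simp) (by simp) (by simp) (by tauto) (by tauto) (by tauto)
  refine ⟨collinear_opposite_faces hV h₁ h₂ h₁' h₂' h₃ h₃' hA3₁ hA3₂ hA3₁₂ hA3₂₁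
    hA1₂ hA1₃ hA1₂₃ hA1₃₂ hcol3, ?_⟩
  refine collinear_opposite_faces hV h₂ h₁ h₂' h₁' (by rwa [Set.pair_comm])
    (by rwa [Set.pair_comm]) hA3₂ hA3₁ hA3₂₁ hA3₁₂ hA2₁ hA2₃ hA2₁₃ hA2₃₁ ?_
  rwa [Set.insert_comm, Set.pair_comm]
end

section
/- Let u, v, a₁, a₂, a₃, a₄, b₁, b₂, b₃, b₄ be pairwise distinct elements of a field K and suppose the multi-ratio equation (b₄, u, a₄, a₂, b₁, v, a₁, b₂) = 1 holds. Then (b₁, v, a₁, a₃, b₄, u, a₄, b₃) = 1 if and only if (a₁, b₂, a₃, b₄) = (b₁, a₂, b₃, a₄). -/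
theorem stmt_16 {K : Type*} [Field K] (u v a₁ a₂ a₃ a₄ b₁ b₂ b₃ b₄ : K)
    (hdist : List.Pairwise (· ≠ ·) [u, v, a₁, a₂, a₃, a₄, b₁, b₂, b₃, b₄])
    (h : multiRatio8 b₄ u a₄ a₂ b₁ v a₁ b₂ = 1) :
    multiRatio8 b₁ v a₁ a₃ b₄ u a₄ b₃ = 1 ↔
      crossRatio a₁ b₂ a₃ b₄ = crossRatio b₁ a₂ b₃ a₄ := by
  simp only [List.pairwise_cons, List.mem_cons, List.not_mem_nil, or_false, forall_eq_or_imp,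
    forall_eq] at hdist
  obtain ⟨⟨-, -, -, -, ua₄, -, -, -, ub₄⟩, ⟨va₁, -, -, -, vb₁, -, -, -⟩,
    ⟨-, -, -, -, -, -, a₁b₄⟩, ⟨-, -, a₂b₁, -, a₂b₃, -⟩, ⟨-, -, b₂a₃, -, a₃b₄⟩,
    ⟨b₁a₄, -, -, -⟩, ⟨-, b₁b₃, -⟩, ⟨-, b₂b₄⟩, -⟩ := hdist
  have hU : (b₄ - u) * (b₁ - v) ≠ 0 :=
    mul_ne_zero (sub_ne_zero.2 ub₄.symm) (sub_ne_zero.2 vb₁.symm)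
  have hD : (a₂ - b₁) * (b₂ - b₄) ≠ 0 := mul_ne_zero (sub_ne_zero.2 a₂b₁) (sub_ne_zero.2 b₂b₄)
  have hF : (b₂ - a₃) * (b₄ - a₁) ≠ 0 :=
    mul_ne_zero (sub_ne_zero.2 b₂a₃.symm) (sub_ne_zero.2 a₁b₄.symm)
  have hG : (a₂ - b₃) * (a₄ - b₁) ≠ 0 := mul_ne_zero (sub_ne_zero.2 a₂b₃) (sub_ne_zero.2 b₁a₄)
  simp only [multiRatio8, crossRatio, div_mul_div_comm] at h ⊢
  rw [div_eq_one_iff_eq (by simp_all [sub_eq_zero, eq_comm])] at h ⊢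
  rw [div_eq_div_iff hF hG]
  constructor
  · intro h'
    apply mul_left_cancel₀ hU
    linear_combination (a₂ - b₁) * (b₂ - b₄) * h' - (a₃ - b₄) * (b₃ - b₁) * h
  · intro h'
    apply mul_left_cancel₀ hD
    linear_combination (a₃ - b₄) * (b₃ - b₁) * h + (b₄ - u) * (b₁ - v) * h'
end

section
/- Let u, v, a₁, a₂, a₃, a₄, b₁, b₂, b₃, b₄ be pairwise distinct elements of a field K and suppose the multi-ratio equation (a₄, u, b₄, a₂, b₁, v, a₁, b₂) = 1 holds. Then (b₁, v, a₁, b₃, a₄, u, b₄, a₃) = 1 if and only if (a₁, b₂, b₃, a₄) = (b₁, a₂, a₃, b₄). -/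
/-- Cross-ratios agree if and only if the ratios `(a - b)(c - d) / ((b - d)(a - c))` do. -/
theorem crossRatio_eq_crossRatio_iff {K : Type*} [Field K] {a b c d a' b' c' d' : K}
    (hbc : b ≠ c) (hda : d ≠ a) (hbc' : b' ≠ c') (hda' : d' ≠ a') :
    crossRatio a b c d = crossRatio a' b' c' d' ↔
      (a - b) * (c - d) * ((b' - d') * (a' - c')) =
        (a' - b') * (c' - d') * ((b - d) * (a - c)) := by
  rw [← sub_ne_zero] at hbc hda hbc' hda'
  unfold crossRatio
  rw [div_mul_div_comm, div_mul_div_comm,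
    div_eq_div_iff (mul_ne_zero hbc hda) (mul_ne_zero hbc' hda')]
  constructor <;> intro h
  · linear_combination -h
  · linear_combination -h

theorem multiRatio8_eq_one_iff {K : Type*} [Field K] {a₁ a₂ a₃ a₄ a₅ a₆ a₇ a₈ : K}
    (h₁ : a₂ ≠ a₃) (h₂ : a₄ ≠ a₅) (h₃ : a₆ ≠ a₇) (h₄ : a₈ ≠ a₁) :
    multiRatio8 a₁ a₂ a₃ a₄ a₅ a₆ a₇ a₈ = 1 ↔
      (a₁ - a₂) * (a₃ - a₄) * (a₅ - a₆) * (a₇ - a₈) =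
        (a₂ - a₃) * (a₄ - a₅) * (a₆ - a₇) * (a₈ - a₁) := by
  rw [← sub_ne_zero] at h₁ h₂ h₃ h₄
  unfold multiRatio8
  rw [div_mul_div_comm, div_mul_div_comm, div_mul_div_comm,
    div_eq_one_iff_eq (mul_ne_zero (mul_ne_zero (mul_ne_zero h₁ h₂) h₃) h₄)]

theorem stmt_17 {K : Type*} [Field K] (u v a₁ a₂ a₃ a₄ b₁ b₂ b₃ b₄ : K)
    (hdist : List.Pairwise (· ≠ ·) [u, v, a₁, a₂, a₃, a₄, b₁, b₂, b₃, b₄])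
    (h : multiRatio8 a₄ u b₄ a₂ b₁ v a₁ b₂ = 1) :
    multiRatio8 b₁ v a₁ b₃ a₄ u b₄ a₃ = 1 ↔
      crossRatio a₁ b₂ b₃ a₄ = crossRatio b₁ a₂ a₃ b₄ := by
  simp only [List.pairwise_cons, List.mem_cons, List.not_mem_nil, or_false, forall_eq_or_imp,
    forall_eq] at hdist
  have hP : (b₄ - a₂) * (a₁ - b₂) ≠ 0 := by
    simp only [ne_eq, mul_eq_zero, sub_eq_zero]
    grind
  have hQ : (u - b₄) * (v - a₁) ≠ 0 := by
    simp only [ne_eq, mul_eq_zero, sub_eq_zero]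
    grind
  rw [multiRatio8_eq_one_iff (by grind) (by grind) (by grind) (by grind)] at h
  rw [multiRatio8_eq_one_iff (by grind) (by grind) (by grind) (by grind),
    crossRatio_eq_crossRatio_iff (by grind) (by grind) (by grind) (by grind)]
  constructor <;> intro e
  · apply mul_left_cancel₀ hQ
    linear_combination (a₁ - b₃) * (b₄ - a₃) * h - (b₄ - a₂) * (a₁ - b₂) * e
  · apply mul_left_cancel₀ hP
    linear_combination (a₁ - b₃) * (b₄ - a₃) * h - (u - b₄) * (v - a₁) * e
end

section
/- (Geometric construction of the Hietarinta equation on the parabola.) Let x, x₁, x₂, x₁₂, o¹, o², e¹, e² be pairwise distinct real numbers and set X = P(x), X₁ = P(x₁), X₂ = P(x₂), X₁₂ = P(x₁₂), O¹ = P(o¹), O² = P(o²), E¹ = P(e¹), E² = P(e²). Suppose there exist points A, B, A', B' ∈ ℝ² with A ≠ B such that: A lies on the lines XO¹ and X₁E¹; B lies on the lines XO² and X₂E²; A' lies on the line X₂O¹ and on the line AB; B' lies on the line X₁O² and on the line AB; and X₁₂ lies on the lines E¹A' and E²B'. Then the multi-ratio equation (x, e², x₁, o¹, x₁₂, o²,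 x₂, e¹) = 1 holds. -/
/-- A point on a chord of the parabola satisfies the equation of that chord. -/
theorem snd_eq_of_mem_chord_s19 {a b : ℝ} {Q : ℝ × ℝ} (h : Q ∈ line[ℝ, Pb a, Pb b]) :
    Q.2 = (a + b) * Q.1 - a * b := by
  obtain ⟨t, rfl⟩ := mem_affineSpan_pair_iff_exists_lineMap_eq.1 h
  simp only [AffineMap.lineMap_apply, Pb, vsub_eq_sub, vadd_eq_add, Prod.fst_add, Prod.snd_add,
    Prod.smul_fst, Prod.smul_snd, Prod.fst_sub, Prod.snd_sub, smul_eq_mul]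
  ring

/-- If `P(b)` lies on the line through `P(a)` and `Q`, then `Q` satisfies the equation of the
chord through `P(a)` and `P(b)`. -/
theorem snd_eq_of_Pb_mem_line {a b : ℝ} {Q : ℝ × ℝ} (hab : a ≠ b)
    (h : Pb b ∈ line[ℝ, Pb a, Q]) : Q.2 = (a + b) * Q.1 - a * b := by
  obtain ⟨t, ht⟩ := mem_affineSpan_pair_iff_exists_lineMap_eq.1 h
  simp only [AffineMap.lineMap_apply, Pb, vsub_eq_sub, vadd_eq_add, Prod.ext_iff, Prod.fst_add,
    Prod.snd_add, Prod.smul_fst, Prod.smul_snd, Prod.fst_sub, Prod.snd_sub, smul_eq_mul] at ht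
  obtain ⟨h₁, h₂⟩ := ht
  have ht0 : t ≠ 0 := by
    rintro rfl
    exact hab (by linarith)
  apply mul_left_cancel₀ ht0
  linear_combination h₂ - (a + b) * h₁

/-- The area determinant of three collinear points of the plane vanishes. -/
theorem det_eq_zero_of_mem_line {A B C : ℝ × ℝ} (h : C ∈ line[ℝ, A, B]) :
    A.1 * (B.2 - C.2) - A.2 * (B.1 - C.1) + (B.1 * C.2 - B.2 * C.1) = 0 := by
  obtain ⟨t, rfl⟩ := mem_affineSpan_pair_iff_exists_lineMap_eq.1 h
  simp only [AffineMap.lineMap_apply, vsub_eq_sub, vadd_eq_add, Prod.fst_add, Prod.snd_add,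
    Prod.smul_fst, Prod.smul_snd, Prod.fst_sub, Prod.snd_sub, smul_eq_mul]
  ring

/-- The homogeneous coordinates of the intersection of the chords `ab` and `cd`. -/
theorem chord_inter_coords {a b c d : ℝ} {Q : ℝ × ℝ} (h : Q.2 = (a + b) * Q.1 - a * b)
    (h' : Q.2 = (c + d) * Q.1 - c * d) :
    (a + b - c - d) * Q.1 = a * b - c * d ∧
      (a + b - c - d) * Q.2 = a * b * (c + d) - c * d * (a + b) := by
  constructor
  · linear_combination h' - h
  · linear_combination (a + b) * h' - (c + d) * h

/-- Geometric construction of the Hietarinta equation on the parabola. -/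
theorem stmt_19 (x x1 x2 x12 o1 o2 e1 e2 : ℝ)
    (hdist : List.Pairwise (· ≠ ·) [x, x1, x2, x12, o1, o2, e1, e2])
    (A B A' B' : ℝ × ℝ) (hAB : A ≠ B)
    (hA : A ∈ line[ℝ, Pb x, Pb o1] ∧ A ∈ line[ℝ, Pb x1, Pb e1])
    (hB : B ∈ line[ℝ, Pb x, Pb o2] ∧ B ∈ line[ℝ, Pb x2, Pb e2])
    (hA' : A' ∈ line[ℝ, Pb x2, Pb o1] ∧ A' ∈ line[ℝ, A, B])
    (hB' : B' ∈ line[ℝ, Pb x1, Pb o2] ∧ B' ∈ line[ℝ, A, B])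
    (hX12 : Pb x12 ∈ line[ℝ, Pb e1, A'] ∧ Pb x12 ∈ line[ℝ, Pb e2, B']) :
    multiRatio8 x e2 x1 o1 x12 o2 x2 e1 = 1 := by
  have cA := chord_inter_coords (snd_eq_of_mem_chord_s19 hA.1) (snd_eq_of_mem_chord_s19 hA.2)
  have cB := chord_inter_coords (snd_eq_of_mem_chord_s19 hB.1) (snd_eq_of_mem_chord_s19 hB.2)
  simp only [List.pairwise_cons, List.mem_cons, List.not_mem_nil, or_false, forall_eq_or_imp,
    forall_eq] at hdist
  have hne : e1 ≠ x12 := by grind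
  have cC := chord_inter_coords (snd_eq_of_mem_chord_s19 hA'.1) (snd_eq_of_Pb_mem_line hne hX12.1)
  have hdet := det_eq_zero_of_mem_line hA'.2
  obtain ⟨a, a'⟩ := A
  obtain ⟨b, b'⟩ := B
  obtain ⟨c, c'⟩ := A'
  dsimp only at cA cB cC hdet
  obtain ⟨cA1, cA2⟩ := cA
  obtain ⟨cB1, cB2⟩ := cB
  obtain ⟨cC1, cC2⟩ := cC
  set dA := x + o1 - x1 - e1 with hdA
  set dB := x + o2 - x2 - e2 with hdB
  set dC := x2 + o1 - e1 - x12 with hdC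
  have hom : dA * a * (dB * b' * dC - dC * c' * dB) - dA * a' * (dB * b * dC - dC * c * dB)
      + dA * (dB * b * (dC * c') - dB * b' * (dC * c)) = 0 := by
    linear_combination dA * dB * dC * hdet
  rw [cA1, cA2, cB1, cB2, cC1, cC2, hdA, hdB, hdC] at hom
  have hx : x - x2 ≠ 0 := sub_ne_zero.2 (by grind)
  have ho : o1 - e1 ≠ 0 := sub_ne_zero.2 (by grind)
  have key : (x - e2) * (x1 - o1) * (x12 - o2) * (x2 - e1)
      = (e2 - x1) * (o1 - x12) * (o2 - x2) * (e1 - x) := by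
    apply mul_left_cancel₀ (mul_ne_zero hx ho)
    linear_combination hom
  have h₁ : e2 - x1 ≠ 0 := sub_ne_zero.2 (by grind)
  have h₂ : o1 - x12 ≠ 0 := sub_ne_zero.2 (by grind)
  have h₃ : o2 - x2 ≠ 0 := sub_ne_zero.2 (by grind)
  have h₄ : e1 - x ≠ 0 := sub_ne_zero.2 (by grind)
  rw [multiRatio8, div_mul_div_comm, div_mul_div_comm, div_mul_div_comm, key]
  exact div_self (by positivity)
end
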